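/- Let 1 ≤ p, q ≤ ∞ and max{1/p − 1/q, 0} < α < ∞, and let R_α : L_p[0,1] → L_q[0,1] be the Riemann–Liouville operator (R_α f)(t) = (1/Γ(α)) ∫_0^t (t−x)^{α−1} f(x) dx. Then e_n(R_α : L_p[0,1] → L_q[0,1]) ∼ n^{−α}, i.e. there exist constants c_1, c_2 > 0 (independent of n) such that c_1 · n^{−α} ≤ e_n(R_α : L_p[0,1] → L_q[0,1]) ≤ c_2 · n^{−α} for all n ∈ ℕ. -/

import Mathlib

open MeasureTheory

/-- The `n`-th entropy number of a subset `A` of a pseudometric space. -/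
noncomputable def entropyNum {X : Type*} [PseudoMetricSpace X] (A : Set X) (n : ℕ) : ℝ :=
  sInf {ε : ℝ | 0 ≤ ε ∧ ∃ T : Finset X, T.card ≤ n ∧ A ⊆ ⋃ x ∈ T, Metric.closedBall x ε}

/-- The `n`-th dyadic entropy number of a subset `A`. -/
noncomputable def dyadEntropyNum {X : Type*} [PseudoMetricSpace X] (A : Set X) (n : ℕ) : ℝ :=
  entropyNum A (2 ^ (n - 1))

/-- The `n`-th entropy number of a bounded linear operator. -/
noncomputable def opEntropyNum {X Y : Type*} [SeminormedAddCommGroup X] [SeminormedAddCommGroup Y]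
    [NormedSpace ℝ X] [NormedSpace ℝ Y] (T : X →L[ℝ] Y) (n : ℕ) : ℝ :=
  entropyNum (T '' Metric.closedBall 0 1) n

/-- The `n`-th dyadic entropy number of a bounded linear operator. -/
noncomputable def opDyadEntropyNum {X Y : Type*} [SeminormedAddCommGroup X]
    [SeminormedAddCommGroup Y] [NormedSpace ℝ X] [NormedSpace ℝ Y]
    (T : X →L[ℝ] Y) (n : ℕ) : ℝ :=
  opEntropyNum T (2 ^ (n - 1))

/-- The absolutely convex hull of a set: all finite sums `∑ λ i • a i` with `∑ |λ i| ≤ 1`. -/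
def absConvHull {X : Type*} [AddCommGroup X] [Module ℝ X] (A : Set X) : Set X :=
  {x | ∃ (n : ℕ) (a : Fin n → X) (lam : Fin n → ℝ),
    (∀ i, a i ∈ A) ∧ (∑ i, |lam i|) ≤ 1 ∧ x = ∑ i, lam i • a i}

/-- The `i`-th Rademacher function. -/
noncomputable def rademacherFn (i : ℕ) (t : ℝ) : ℝ :=
  Real.sign (Real.sin (2 ^ i * Real.pi * t))

/-- `X` is of type `p` with constant `ρ`. -/
def IsTypePWith (X : Type*) [SeminormedAddCommGroup X] [NormedSpace ℝ X] (p ρ : ℝ) : Prop :=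
  ∀ (k : ℕ) (x : Fin k → X),
    (∫ t in (0:ℝ)..1, ‖∑ i : Fin k, rademacherFn (i.1 + 1) t • x i‖) ≤
      ρ * (∑ i : Fin k, ‖x i‖ ^ p) ^ (1 / p)

/-- `X` is a Banach space of type `p`. -/
def IsTypeP (X : Type*) [SeminormedAddCommGroup X] [NormedSpace ℝ X] (p : ℝ) : Prop :=
  ∃ ρ > 0, IsTypePWith X p ρ

/-- Membership in the generalized Lorentz sequence space `l_{r,s,α}`, `0 < s < ∞`:
`∑_{n ≥ 1} (log₂(n+1))^{-αs} n^{s/r-1} ξ_n^s < ∞`. -/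
def MemLorentz (r s α : ℝ) (ξ : ℕ → ℝ) : Prop :=
  Summable fun n : ℕ =>
    (Real.logb 2 ((n : ℝ) + 2)) ^ (-(α * s)) * ((n : ℝ) + 1) ^ (s / r - 1) * ξ (n + 1) ^ s

/-- Membership in the generalized Lorentz sequence space `l_{r,∞,α}`:
`sup_{n ≥ 1} (log₂(n+1))^{-α} n^{1/r} ξ_n < ∞`. -/
def MemLorentzTop (r α : ℝ) (ξ : ℕ → ℝ) : Prop :=
  ∃ C : ℝ, ∀ n : ℕ, 1 ≤ n →
    (Real.logb 2 ((n : ℝ) + 1)) ^ (-α) * (n : ℝ) ^ (1 / r) * ξ n ≤ C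

/-- The `n`-th Kolmogorov number of a bounded linear operator. -/
noncomputable def kolmogorovNum {X Y : Type*} [SeminormedAddCommGroup X] [NormedSpace ℝ X]
    [NormedAddCommGroup Y] [NormedSpace ℝ Y] (T : X →L[ℝ] Y) (n : ℕ) : ℝ :=
  sInf {c : ℝ | ∃ F : Submodule ℝ Y, Module.rank ℝ F < (n : Cardinal) ∧
    ∀ x ∈ Metric.closedBall (0 : X) 1, Metric.infDist (T x) (F : Set Y) ≤ c}

/-- The `l`-norm of an operator from a finite-dimensional Euclidean space. -/
noncomputable def ellNormFin {Y : Type*} [SeminormedAddCommGroup Y] [NormedSpace ℝ Y] {n : ℕ}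
    (S : EuclideanSpace ℝ (Fin n) →L[ℝ] Y) : ℝ :=
  (∫ x : Fin n → ℝ, ‖S ((WithLp.equiv 2 (Fin n → ℝ)).symm x)‖ ^ 2
      ∂(Measure.pi fun _ : Fin n => ProbabilityTheory.gaussianReal 0 1)) ^ ((1 : ℝ) / 2)

/-- The `l`-norm of an operator between Banach spaces. -/
noncomputable def ellNorm {X Y : Type*} [SeminormedAddCommGroup X] [NormedSpace ℝ X]
    [SeminormedAddCommGroup Y] [NormedSpace ℝ Y] (T : X →L[ℝ] Y) : ℝ :=
  sSup {c : ℝ | ∃ (n : ℕ) (A : EuclideanSpace ℝ (Fin n) →L[ℝ] X),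
    ‖A‖ ≤ 1 ∧ c = ellNormFin (T.comp A)}

/-- The `n`-th approximation number of `T` with respect to the `l`-norm. -/
noncomputable def approxNumEll {X Y : Type*} [SeminormedAddCommGroup X] [NormedSpace ℝ X]
    [SeminormedAddCommGroup Y] [NormedSpace ℝ Y] (T : X →L[ℝ] Y) (n : ℕ) : ℝ :=
  sInf {c : ℝ | ∃ A : X →L[ℝ] Y,
    Module.rank ℝ (LinearMap.range (A : X →ₗ[ℝ] Y)) < (n : Cardinal) ∧ c = ellNorm (T - A)}

namespace RiemannLiouville

open Set Filter Topology
open scoped ENNReal NNReal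

/-- Lebesgue measure on `[0,1]`. -/
noncomputable abbrev unitVol : Measure ℝ := volume.restrict (Set.Icc (0:ℝ) 1)

instance : IsProbabilityMeasure unitVol := ⟨by simp [unitVol]⟩

/-- The kernel `y ↦ y^(α-1)/Γ(α)` cut off to `(0,1]`. -/
noncomputable def kern (α y : ℝ) : ℝ := if 0 < y ∧ y ≤ 1 then y ^ (α - 1) / Real.Gamma α else 0

/-- The Riemann–Liouville operator on functions on `[0,1]`. -/
noncomputable def RL (α : ℝ) (f : ℝ → ℝ) (t : ℝ) : ℝ := ∫ x, kern α (t - x) * f x ∂unitVol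

lemma measurable_kern (α : ℝ) : Measurable (kern α) := by
  unfold kern
  apply Measurable.ite
  · exact measurableSet_Ioc
  · fun_prop
  · fun_prop

lemma kern_nonneg {α : ℝ} (hα : 0 < α) (y : ℝ) : 0 ≤ kern α y := by
  unfold kern
  split_ifs with h
  · exact div_nonneg (Real.rpow_nonneg h.1.le _) (Real.Gamma_pos_of_pos hα).le
  · exact le_rfl

lemma integrable_kern {α : ℝ} (hα : 0 < α) : Integrable (kern α) := by
  have h : IntegrableOn (fun y : ℝ => y ^ (α - 1) / Real.Gamma α) (Ioc 0 1) := by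
    rw [← intervalIntegrable_iff_integrableOn_Ioc_of_le zero_le_one]
    exact (intervalIntegral.intervalIntegrable_rpow' (by linarith)).div_const _
  refine (h.integrable_indicator measurableSet_Ioc).congr (Eventually.of_forall fun y => ?_)
  simp only [indicator, mem_Ioc, kern]

/-- Jensen's inequality for a kernel. -/
lemma lintegral_mul_rpow_le {μ : Measure ℝ} [SFinite μ] {H F : ℝ → ℝ≥0∞} (hH : AEMeasurable H μ)
    (hF : AEMeasurable F μ) {p : ℝ} (hp : 1 ≤ p) :
    (∫⁻ x, H x * F x ∂μ) ^ p ≤ (∫⁻ x, H x ∂μ) ^ (p - 1) * ∫⁻ x, H x * F x ^ p ∂μ := by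
  have key := eLpNorm_le_eLpNorm_mul_rpow_measure_univ (μ := μ.withDensity H) (f := F)
    (p := 1) (q := ENNReal.ofReal p) (by simpa using hp)
    (hF.mono_ac (withDensity_absolutelyContinuous _ _)).aestronglyMeasurable
  have hp0 : 0 < p := by linarith
  rw [eLpNorm_one_eq_lintegral_enorm, eLpNorm_eq_lintegral_rpow_enorm_toReal (by simpa using hp0)
    (by simp)] at key
  simp only [enorm_eq_self, ENNReal.toReal_ofReal hp0.le, withDensity_apply _ MeasurableSet.univ,
    Measure.restrict_univ, ENNReal.toReal_one] at key
  rw [lintegral_withDensity_eq_lintegral_mul₀ hH hF,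
    lintegral_withDensity_eq_lintegral_mul₀ hH (hF.pow_const p)] at key
  calc _ ≤ _ := ENNReal.rpow_le_rpow key hp0.le
    _ = _ := by
      rw [ENNReal.mul_rpow_of_nonneg _ _ hp0.le, ← ENNReal.rpow_mul, ← ENNReal.rpow_mul, mul_comm]
      congr 2
      · field_simp
      · rw [one_div_mul_cancel hp0.ne', ENNReal.rpow_one]
        rfl

/-- Young's inequality `L₁ * L_p ⊂ L_p` on the unit interval. -/
lemma lintegral_young {H F : ℝ → ℝ≥0∞} (hH : Measurable H) (hF : AEMeasurable F unitVol)
    {p : ℝ} (hp : 1 ≤ p) :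
    ∫⁻ t, (∫⁻ x, H (t - x) * F x ∂unitVol) ^ p ∂unitVol
      ≤ (∫⁻ y, H y) ^ p * ∫⁻ x, F x ^ p ∂unitVol := by
  have hp0 : 0 < p := by linarith
  have h1 : ∀ t, ∫⁻ x, H (t - x) ∂unitVol ≤ ∫⁻ y, H y := fun t =>
    (lintegral_mono' Measure.restrict_le_self le_rfl).trans (lintegral_sub_left_eq_self H t).le
  have h2 : ∀ x, ∫⁻ t, H (t - x) ∂unitVol ≤ ∫⁻ y, H y := fun x =>
    (lintegral_mono' Measure.restrict_le_self le_rfl).trans (lintegral_sub_right_eq_self H x).le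
  calc _ ≤ ∫⁻ t, (∫⁻ y, H y) ^ (p - 1) * ∫⁻ x, H (t - x) * F x ^ p ∂unitVol ∂unitVol := by
        refine lintegral_mono fun t => ?_
        refine (lintegral_mul_rpow_le (by fun_prop) hF hp).trans ?_
        exact mul_le_mul' (ENNReal.rpow_le_rpow (h1 t) (sub_nonneg.2 hp)) le_rfl
    _ ≤ (∫⁻ y, H y) ^ (p - 1) * ∫⁻ t, ∫⁻ x, H (t - x) * F x ^ p ∂unitVol ∂unitVol := by
        rw [lintegral_const_mul'']
        apply AEMeasurable.lintegral_prod_right' (f := fun z : ℝ × ℝ => H (z.1 - z.2) * F z.2 ^ p)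
        refine AEMeasurable.mul (by fun_prop) ?_
        exact (hF.pow_const p).comp_snd
    _ = (∫⁻ y, H y) ^ (p - 1) * ∫⁻ x, (∫⁻ t, H (t - x) ∂unitVol) * F x ^ p ∂unitVol := by
        rw [lintegral_lintegral_swap]
        · congr 1
          refine lintegral_congr fun x => ?_
          rw [lintegral_mul_const _ (by fun_prop)]
        · refine AEMeasurable.mul (by fun_prop) ?_
          exact (hF.pow_const p).comp_snd
    _ ≤ (∫⁻ y, H y) ^ (p - 1) * ∫⁻ x, (∫⁻ y, H y) * F x ^ p ∂unitVol := by
        exact mul_le_mul' le_rfl (lintegral_mono fun x => mul_le_mul' (h2 x) le_rfl)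
    _ = (∫⁻ y, H y) ^ p * ∫⁻ x, F x ^ p ∂unitVol := by
        rw [lintegral_const_mul'' _ (hF.pow_const p), ← mul_assoc]
        congr 1
        nth_rewrite 2 [← ENNReal.rpow_one (∫⁻ y, H y)]
        rw [← ENNReal.rpow_add_of_nonneg _ _ (by linarith) (by norm_num)]
        congr 1
        ring

lemma eLpNorm_young {g f : ℝ → ℝ} {H : ℝ → ℝ≥0∞} (hH : Measurable H)
    (hf : AEStronglyMeasurable f unitVol) {p : ℝ} (hp : 1 ≤ p)
    (h : ∀ᵐ t ∂unitVol, ‖g t‖ₑ ≤ ∫⁻ x, H (t - x) * ‖f x‖ₑ ∂unitVol) :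
    eLpNorm g (ENNReal.ofReal p) unitVol
      ≤ (∫⁻ y, H y) * eLpNorm f (ENNReal.ofReal p) unitVol := by
  have hp0 : 0 < p := by linarith
  rw [eLpNorm_eq_lintegral_rpow_enorm_toReal (by simpa using hp0) (by simp),
    eLpNorm_eq_lintegral_rpow_enorm_toReal (by simpa using hp0) (by simp),
    ENNReal.toReal_ofReal hp0.le]
  calc _ ≤ ((∫⁻ y, H y) ^ p * ∫⁻ x, ‖f x‖ₑ ^ p ∂unitVol) ^ (1 / p) := by
        refine ENNReal.rpow_le_rpow ?_ (by positivity)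
        refine (lintegral_mono_ae ?_).trans (lintegral_young hH hf.enorm hp)
        filter_upwards [h] with t ht
        exact ENNReal.rpow_le_rpow ht hp0.le
    _ = _ := by
        rw [ENNReal.mul_rpow_of_nonneg _ _ (by positivity), ← ENNReal.rpow_mul,
          mul_one_div_cancel hp0.ne', ENNReal.rpow_one]

lemma lintegral_enorm_kern_lt_top {α : ℝ} (hα : 0 < α) : ∫⁻ y, ‖kern α y‖ₑ < ∞ :=
  (integrable_kern hα).2

lemma ae_integrable_kern_mul {α : ℝ} (hα : 0 < α) {f : ℝ → ℝ} (hf : Integrable f unitVol) :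
    ∀ᵐ t ∂unitVol, Integrable (fun x => kern α (t - x) * f x) unitVol := by
  have hk := measurable_kern α
  have h := lintegral_young (H := fun y => ‖kern α y‖ₑ) (F := fun x => ‖f x‖ₑ) (by fun_prop)
    hf.1.enorm le_rfl
  simp only [ENNReal.rpow_one] at h
  have h2 := ae_lt_top' (μ := unitVol) (f := fun t => ∫⁻ x, ‖kern α (t - x)‖ₑ * ‖f x‖ₑ ∂unitVol) ?_
    (h.trans_lt (ENNReal.mul_lt_top (lintegral_enorm_kern_lt_top hα) hf.2)).ne
  · filter_upwards [h2] with t ht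
    refine ⟨(Measurable.aestronglyMeasurable (by fun_prop)).mul hf.1, ?_⟩
    simpa [HasFiniteIntegral, enorm_mul] using ht
  · apply AEMeasurable.lintegral_prod_right'
      (f := fun z : ℝ × ℝ => ‖kern α (z.1 - z.2)‖ₑ * ‖f z.2‖ₑ)
    exact AEMeasurable.mul (by fun_prop) (hf.1.enorm.comp_snd)

lemma aestronglyMeasurable_RL (α : ℝ) {f : ℝ → ℝ} (hf : AEStronglyMeasurable f unitVol) :
    AEStronglyMeasurable (RL α f) unitVol := by
  have hk := measurable_kern α
  apply AEStronglyMeasurable.integral_prod_right' (f := fun z : ℝ × ℝ => kern α (z.1 - z.2) * f z.2)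
  exact (Measurable.aestronglyMeasurable (by fun_prop)).mul hf.comp_snd

lemma RL_eq_intervalIntegral (α : ℝ) (f : ℝ → ℝ) {t : ℝ} (ht : t ∈ Icc (0:ℝ) 1) :
    RL α f t = (1 / Real.Gamma α) * ∫ x in (0:ℝ)..t, (t - x) ^ (α - 1) * f x := by
  rw [intervalIntegral.integral_of_le ht.1, ← integral_Icc_eq_integral_Ioc,
    integral_Icc_eq_integral_Ico, RL, ← integral_const_mul,
    ← integral_indicator measurableSet_Ico, ← integral_indicator measurableSet_Icc]
  congr 1
  ext x
  simp only [indicator, mem_Icc, mem_Ico, kern]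
  split_ifs with h1 h2 h3 h4 h5
  · ring
  · exact absurd ⟨h1.1, by linarith⟩ h3
  · exact absurd ⟨by linarith [h4.2], by linarith [h1.1, ht.2]⟩ h2
  · ring
  · exact absurd ⟨h5.1, by linarith [h5.2, ht.2]⟩ h1
  · rfl

lemma RL_congr (α : ℝ) {f g : ℝ → ℝ} (h : f =ᵐ[unitVol] g) (t : ℝ) : RL α f t = RL α g t := by
  refine integral_congr_ae ?_
  filter_upwards [h] with x hx
  rw [hx]

lemma RL_const_mul (α c : ℝ) (f : ℝ → ℝ) (t : ℝ) :
    RL α (fun x => c * f x) t = c * RL α f t := by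
  rw [RL, RL, ← integral_const_mul]
  congr 1
  ext x
  ring

lemma RL_sub {α : ℝ} (hα : 0 < α) {f g : ℝ → ℝ} (hf : Integrable f unitVol)
    (hg : Integrable g unitVol) :
    ∀ᵐ t ∂unitVol, RL α (fun x => f x - g x) t = RL α f t - RL α g t := by
  filter_upwards [ae_integrable_kern_mul hα hf, ae_integrable_kern_mul hα hg] with t h1 h2
  rw [RL, RL, RL, ← integral_sub h1 h2]
  congr 1
  ext x
  ring

lemma kern_mul_kern {α β : ℝ} (hα : 0 < α) (hβ : 0 < β) {x s t : ℝ} (hxt : t - x ≤ 1)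
    (h0 : x < t) :
    kern β (t - s) * kern α (s - x) = kern (α + β) (t - x) *
      ((t - x)⁻¹ * ProbabilityTheory.betaPDFReal α β ((s - x) / (t - x))) := by
  have hy : 0 < t - x := by linarith
  have hG := Real.Gamma_pos_of_pos hα
  have hG' := Real.Gamma_pos_of_pos hβ
  have hG'' := Real.Gamma_pos_of_pos (add_pos hα hβ)
  have e : 0 < (s - x) / (t - x) ∧ (s - x) / (t - x) < 1 ↔ 0 < s - x ∧ 0 < t - s := by
    rw [div_lt_one hy, div_pos_iff_of_pos_right hy]
    constructor <;> rintro ⟨h1, h2⟩ <;> constructor <;> linarith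
  unfold ProbabilityTheory.betaPDFReal
  by_cases h : 0 < s - x ∧ 0 < t - s
  · rw [if_pos (e.2 h)]
    rw [kern, kern, kern, if_pos ⟨h.2, by linarith⟩, if_pos ⟨h.1, by linarith⟩, if_pos ⟨hy, hxt⟩,
      ProbabilityTheory.beta]
    have : 1 - (s - x) / (t - x) = (t - s) / (t - x) := by field_simp; ring
    rw [this, Real.div_rpow h.1.le hy.le, Real.div_rpow h.2.le hy.le]
    have e2 : (t - x) ^ (α + β - 1) = (t - x) ^ (α - 1) * (t - x) ^ (β - 1) * (t - x) := by
      nth_rewrite 4 [← Real.rpow_one (t - x)]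
      rw [← Real.rpow_add hy, ← Real.rpow_add hy]
      congr 1
      ring
    rw [e2]
    have := Real.rpow_pos_of_pos hy (α - 1)
    have := Real.rpow_pos_of_pos hy (β - 1)
    field_simp
  · rw [if_neg (fun h' => h (e.1 h')), mul_zero, mul_zero]
    rw [not_and_or] at h
    rcases h with h | h
    · rw [kern, kern, if_neg (c := 0 < s - x ∧ _) (fun h' => h h'.1), mul_zero]
    · rw [kern, if_neg (fun h' => h h'.1), zero_mul]

lemma integrable_betaPDFReal {α β : ℝ} (hα : 0 < α) (hβ : 0 < β) :
    Integrable (ProbabilityTheory.betaPDFReal α β) ∧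
      ∫ x, ProbabilityTheory.betaPDFReal α β x = 1 := by
  have hnn : 0 ≤ᵐ[volume] ProbabilityTheory.betaPDFReal α β := by
    refine Eventually.of_forall fun x => ?_
    by_cases h : 0 < x ∧ x < 1
    · exact (ProbabilityTheory.betaPDFReal_pos h.1 h.2 hα hβ).le
    · simp [ProbabilityTheory.betaPDFReal, if_neg h]
  have hm := (ProbabilityTheory.measurable_betaPDFReal α β).aestronglyMeasurable (μ := volume)
  have h1 := ProbabilityTheory.lintegral_betaPDF_eq_one hα hβ
  unfold ProbabilityTheory.betaPDF at h1
  refine ⟨⟨hm, ?_⟩, ?_⟩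
  · rw [hasFiniteIntegral_iff_ofReal hnn, h1]
    simp
  · rw [integral_eq_lintegral_of_nonneg_ae hnn hm, h1]
    simp

lemma integrable_kern_mul_kern {α β : ℝ} (hα : 0 < α) (hβ : 0 < β) {x t : ℝ}
    (hx : x ∈ Icc (0:ℝ) 1) (ht : t ∈ Icc (0:ℝ) 1) :
    Integrable (fun s => kern β (t - s) * kern α (s - x)) unitVol ∧
      ∫ s, kern β (t - s) * kern α (s - x) ∂unitVol = kern (α + β) (t - x) := by
  rcases lt_or_ge x t with h0 | h0
  · have hxt : t - x ≤ 1 := by linarith [ht.2, hx.1]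
    have hy : 0 < t - x := by linarith
    obtain ⟨hi, he⟩ := integrable_betaPDFReal hα hβ
    have hi' : Integrable (fun s => kern β (t - s) * kern α (s - x)) := by
      simp_rw [kern_mul_kern hα hβ hxt h0]
      exact (((hi.comp_div hy.ne').comp_sub_right x).const_mul _).const_mul _
    refine ⟨hi'.mono_measure Measure.restrict_le_self, ?_⟩
    rw [setIntegral_eq_integral_of_forall_compl_eq_zero]
    · simp_rw [kern_mul_kern hα hβ hxt h0]
      rw [integral_const_mul, integral_const_mul,
        integral_sub_right_eq_self (fun s => ProbabilityTheory.betaPDFReal α β (s / (t - x))),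
        Measure.integral_comp_div, he, abs_of_pos hy]
      simp [hy.ne']
    · intro s hs
      by_cases h : 0 < s - x ∧ 0 < t - s
      · exact absurd ⟨by linarith [hx.1], by linarith [ht.2]⟩ hs
      · rw [not_and_or] at h
        rcases h with h | h
        · rw [kern, kern, if_neg (c := 0 < s - x ∧ _) (fun h' => h h'.1), mul_zero]
        · rw [kern, if_neg (fun h' => h h'.1), zero_mul]
  · have h1 : ∀ s, kern β (t - s) * kern α (s - x) = 0 := by
      intro s
      by_cases h : 0 < s - x
      · rw [kern, if_neg (fun h' => by linarith [h'.1]), zero_mul]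
      · rw [kern, kern, if_neg (c := 0 < s - x ∧ _) (fun h' => h h'.1), mul_zero]
    simp_rw [h1]
    simp [kern, h0.not_gt]

/-- The semigroup property of the Riemann–Liouville operators. -/
lemma RL_RL {α β : ℝ} (hα : 0 < α) (hβ : 0 < β) {f : ℝ → ℝ} (hf : Integrable f unitVol) :
    ∀ᵐ t ∂unitVol, RL β (RL α f) t = RL (α + β) f t := by
  have hkα := measurable_kern α
  have hkβ := measurable_kern β
  filter_upwards [ae_integrable_kern_mul (add_pos hα hβ) hf,
    ae_restrict_mem measurableSet_Icc] with t hft ht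
  have hmem : ∀ᵐ x ∂unitVol, x ∈ Icc (0:ℝ) 1 := ae_restrict_mem measurableSet_Icc
  have hgi : Integrable (Function.uncurry fun s x => kern β (t - s) * kern α (s - x) * f x)
      (unitVol.prod unitVol) := by
    refine (integrable_prod_iff' ?_).2 ⟨?_, ?_⟩
    · exact (Measurable.aestronglyMeasurable (by fun_prop)).mul hf.1.comp_snd
    · filter_upwards [hmem] with x hx
      exact (integrable_kern_mul_kern hα hβ hx ht).1.mul_const (f x)
    · refine hft.norm.congr ?_
      filter_upwards [hmem] with x hx
      simp only [Function.uncurry, norm_mul]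
      rw [integral_mul_const, ← (integrable_kern_mul_kern hα hβ hx ht).2]
      rw [Real.norm_of_nonneg
        (integral_nonneg fun s => mul_nonneg (kern_nonneg hβ _) (kern_nonneg hα _))]
      congr 2
      ext s
      rw [Real.norm_of_nonneg (kern_nonneg hβ _), Real.norm_of_nonneg (kern_nonneg hα _)]
  have : RL β (RL α f) t = ∫ s, ∫ x, kern β (t - s) * kern α (s - x) * f x ∂unitVol ∂unitVol := by
    simp only [RL]
    congr 1
    ext s
    rw [← integral_const_mul]
    simp_rw [mul_assoc]
  rw [this, integral_integral_swap hgi, RL]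
  refine integral_congr_ae ?_
  filter_upwards [hmem] with x hx
  rw [integral_mul_const, (integrable_kern_mul_kern hα hβ hx ht).2]

/-- The image of the `L_p` unit ball under `RL α` is covered by `N` balls of radius `ε` in `L_q`. -/
def Covers (α : ℝ) (p q : ℝ≥0∞) (N : ℕ) (ε : ℝ) : Prop :=
  ∃ S : Finset (ℝ → ℝ), S.card ≤ N ∧ (∀ h ∈ S, MemLp h q unitVol) ∧
    ∀ f : ℝ → ℝ, MemLp f p unitVol → eLpNorm f p unitVol ≤ 1 →
      ∃ h ∈ S, eLpNorm (fun t => RL α f t - h t) q unitVol ≤ ENNReal.ofReal ε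

lemma Covers.mono {α : ℝ} {p q p' q' : ℝ≥0∞} {N N' : ℕ} {ε ε' : ℝ} (h : Covers α p q N ε)
    (hp : p ≤ p') (hq : q' ≤ q) (hN : N ≤ N') (hε : ε ≤ ε') : Covers α p' q' N' ε' := by
  obtain ⟨S, hc, hm, hS⟩ := h
  refine ⟨S, hc.trans hN, fun h hh => (hm h hh).mono_exponent hq, fun f hf hf1 => ?_⟩
  obtain ⟨h, hh, he⟩ := hS f (hf.mono_exponent hp)
    ((eLpNorm_le_eLpNorm_of_exponent_le hp hf.1).trans hf1)
  exact ⟨h, hh, (eLpNorm_le_eLpNorm_of_exponent_le hq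
    ((aestronglyMeasurable_RL α hf.1).sub (hm h hh).1)).trans
      (he.trans (ENNReal.ofReal_le_ofReal hε))⟩

lemma eLpNorm_const_mul_fun (c : ℝ) (f : ℝ → ℝ) (p : ℝ≥0∞) :
    eLpNorm (fun t => c * f t) p unitVol = ENNReal.ofReal |c| * eLpNorm f p unitVol := by
  have := eLpNorm_const_smul c f p unitVol
  rw [← Real.enorm_eq_ofReal_abs, ← this]
  rfl

lemma Covers.memLp {α : ℝ} {p q : ℝ≥0∞} {N : ℕ} {ε : ℝ} (h : Covers α p q N ε)
    {f : ℝ → ℝ} (hf : MemLp f p unitVol) : MemLp (RL α f) q unitVol := by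
  obtain ⟨S, -, hm, hS⟩ := h
  obtain ⟨c, hc, hc1⟩ : ∃ c : ℝ, 0 < c ∧ eLpNorm f p unitVol ≤ ENNReal.ofReal c := by
    refine ⟨(eLpNorm f p unitVol).toReal + 1, by positivity, ?_⟩
    rw [ENNReal.le_ofReal_iff_toReal_le hf.2.ne (by positivity)]
    linarith
  obtain ⟨h, hh, he⟩ := hS (fun t => c⁻¹ * f t) (hf.const_mul c⁻¹) (by
    rw [eLpNorm_const_mul_fun, abs_of_pos (by positivity)]
    calc _ ≤ ENNReal.ofReal c⁻¹ * ENNReal.ofReal c := mul_le_mul' le_rfl hc1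
      _ = 1 := by rw [← ENNReal.ofReal_mul (by positivity), inv_mul_cancel₀ hc.ne']; simp)
  have h1 : MemLp (fun t => RL α (fun t => c⁻¹ * f t) t - h t) q unitVol :=
    ⟨(aestronglyMeasurable_RL α (hf.const_mul c⁻¹).1).sub (hm h hh).1,
      he.trans_lt ENNReal.ofReal_lt_top⟩
  have h2 := (h1.add (hm h hh)).const_mul c
  refine h2.congr_norm (aestronglyMeasurable_RL α hf.1) (Eventually.of_forall fun t => ?_)
  simp only [Pi.add_apply, sub_add_cancel, RL_const_mul]
  rw [mul_inv_cancel_left₀ hc.ne']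

lemma Covers.one {α : ℝ} {p q : ℝ≥0∞} {N : ℕ} {ε : ℝ} (hq : 1 ≤ q)
    (h : Covers α p q N ε) : ∃ C > 0, Covers α p q 1 C := by
  obtain ⟨S, -, hm, hS⟩ := h
  have hfin : ENNReal.ofReal ε + ∑ h ∈ S, eLpNorm h q unitVol < ∞ :=
    ENNReal.add_lt_top.2 ⟨ENNReal.ofReal_lt_top, ENNReal.sum_lt_top.2 fun h hh => (hm h hh).2⟩
  refine ⟨(ENNReal.ofReal ε + ∑ h ∈ S, eLpNorm h q unitVol).toReal + 1, by positivity,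
    {fun _ => 0}, by simp, by simp, fun f hf hf1 => ⟨_, Finset.mem_singleton_self _, ?_⟩⟩
  obtain ⟨h, hh, he⟩ := hS f hf hf1
  rw [ENNReal.le_ofReal_iff_toReal_le _ (by positivity)]
  · refine le_trans (ENNReal.toReal_mono hfin.ne ?_) (le_add_of_nonneg_right zero_le_one)
    have e : (fun t => RL α f t - 0) = (fun t => RL α f t - h t) + h := by
      ext t; simp
    rw [e]
    refine (eLpNorm_add_le ((aestronglyMeasurable_RL α hf.1).sub (hm h hh).1) (hm h hh).1 hq).trans ?_
    exact add_le_add he (Finset.single_le_sum (f := fun h => eLpNorm h q unitVol) (by simp) hh)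
  · have := (Covers.memLp (N := S.card) ⟨S, le_rfl, hm, hS⟩ hf).2.ne
    simpa using this

lemma Covers.comp {α β : ℝ} {p r q : ℝ≥0∞} {N₁ N₂ : ℕ} {ε₁ ε₂ : ℝ} (hα : 0 < α) (hβ : 0 < β)
    (hp : 1 ≤ p) (hr : 1 ≤ r) (hε : 0 < ε₁) (h₁ : Covers α p r N₁ ε₁)
    (h₂ : Covers β r q N₂ ε₂) : Covers (α + β) p q (N₁ * N₂) (ε₁ * ε₂) := by
  classical
  obtain ⟨S₁, hc₁, hm₁, hS₁⟩ := h₁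
  have h₂' := h₂
  obtain ⟨S₂, hc₂, hm₂, hS₂⟩ := h₂
  refine ⟨(S₁ ×ˢ S₂).image fun z t => RL β z.1 t + ε₁ * z.2 t, ?_, ?_, ?_⟩
  · exact Finset.card_image_le.trans (by rw [Finset.card_product]; exact Nat.mul_le_mul hc₁ hc₂)
  · intro h hh
    obtain ⟨z, hz, rfl⟩ := Finset.mem_image.1 hh
    rw [Finset.mem_product] at hz
    exact (h₂'.memLp (hm₁ _ hz.1)).add ((hm₂ _ hz.2).const_mul ε₁)
  · intro f hf hf1
    obtain ⟨h, hh, he⟩ := hS₁ f hf hf1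
    have hfi := hf.integrable hp
    have hd : MemLp (fun t => RL α f t - h t) r unitVol :=
      ⟨(aestronglyMeasurable_RL α hf.1).sub (hm₁ h hh).1, he.trans_lt ENNReal.ofReal_lt_top⟩
    have hRi : Integrable (RL α f) unitVol := by
      have := (hd.add (hm₁ h hh)).integrable hr
      refine this.congr (Eventually.of_forall fun t => ?_)
      simp
    obtain ⟨g, hg, hge⟩ := hS₂ (fun t => ε₁⁻¹ * (RL α f t - h t)) (hd.const_mul _) (by
      rw [eLpNorm_const_mul_fun, abs_of_pos (by positivity)]
      calc _ ≤ ENNReal.ofReal ε₁⁻¹ * ENNReal.ofReal ε₁ := mul_le_mul' le_rfl he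
        _ = 1 := by rw [← ENNReal.ofReal_mul (by positivity), inv_mul_cancel₀ hε.ne']; simp)
    refine ⟨_, Finset.mem_image.2 ⟨(h, g), Finset.mem_product.2 ⟨hh, hg⟩, rfl⟩, ?_⟩
    rw [ENNReal.ofReal_mul hε.le, ← abs_of_pos hε]
    refine le_trans (le_of_eq ?_) (mul_le_mul' le_rfl hge)
    rw [← eLpNorm_const_mul_fun, abs_of_pos hε]
    refine eLpNorm_congr_ae ?_
    filter_upwards [RL_RL hα hβ hfi, RL_sub hβ hRi ((hm₁ h hh).integrable hr)] with t h1 h2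
    rw [RL_const_mul, h2, h1]
    field_simp
    ring

/-- Upper estimate of the dyadic entropy numbers of order `n^(-α)`. -/
def UpperBound (α : ℝ) (p q : ℝ≥0∞) : Prop :=
  ∃ C > 0, ∀ n : ℕ, 1 ≤ n → Covers α p q (2 ^ (n - 1)) (C * (n : ℝ) ^ (-α))

lemma UpperBound.mono {α : ℝ} {p q p' q' : ℝ≥0∞} (h : UpperBound α p q)
    (hp : p ≤ p') (hq : q' ≤ q) : UpperBound α p' q' := by
  obtain ⟨C, hC, h⟩ := h
  exact ⟨C, hC, fun n hn => (h n hn).mono hp hq le_rfl le_rfl⟩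

lemma UpperBound.comp {α β : ℝ} {p r q : ℝ≥0∞} (hα : 0 < α) (hβ : 0 < β)
    (hp : 1 ≤ p) (hr : 1 ≤ r) (h₁ : UpperBound α p r) (h₂ : UpperBound β r q) :
    UpperBound (α + β) p q := by
  obtain ⟨C₁, hC₁, h₁⟩ := h₁
  obtain ⟨C₂, hC₂, h₂⟩ := h₂
  refine ⟨C₁ * C₂ * 2 ^ (α + β), by positivity, fun n hn => ?_⟩
  have hm : 1 ≤ (n + 1) / 2 := by omega
  have hm0 : (0:ℝ) < ((n + 1) / 2 : ℕ) := by exact_mod_cast hm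
  refine ((h₁ _ hm).comp hα hβ hp hr (by positivity) (h₂ _ hm)).mono le_rfl le_rfl ?_ ?_
  · rw [← pow_add]
    exact Nat.pow_le_pow_right (by norm_num) (by omega)
  · have hn0 : (0:ℝ) < n := by exact_mod_cast hn
    have h2 : (n:ℝ) / 2 ≤ ((n + 1) / 2 : ℕ) := by
      rw [div_le_iff₀ (by norm_num)]
      exact_mod_cast (by omega : n ≤ (n + 1) / 2 * 2)
    have h3 : (((n + 1) / 2 : ℕ) : ℝ) ^ (-(α + β)) ≤ ((n:ℝ) / 2) ^ (-(α + β)) :=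
      Real.rpow_le_rpow_of_nonpos (by positivity) h2 (by linarith)
    calc _ = C₁ * C₂ * (((n + 1) / 2 : ℕ) : ℝ) ^ (-(α + β)) := by
          rw [neg_add, Real.rpow_add hm0]; ring
      _ ≤ C₁ * C₂ * ((n:ℝ) / 2) ^ (-(α + β)) := by gcongr
      _ = _ := by
          rw [Real.div_rpow hn0.le (by norm_num), Real.rpow_neg (by norm_num : (0:ℝ) ≤ 2)]
          field_simp

/-- The value of the step approximation of `RL α f` on the `j`-th of `N` equal cells. -/
noncomputable def coef (α : ℝ) (f : ℝ → ℝ) (N j : ℕ) : ℝ :=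
  ∫ x : ℝ, (if x < j / N then ((j + 1) / N - x) ^ (α - 1) / Real.Gamma α else 0) * f x ∂unitVol

/-- The kernel dominating the error of the step approximation with cells of length `δ`. -/
noncomputable def diffKern (α δ y : ℝ) : ℝ :=
  kern α y - (Ioc δ 1).indicator (fun y => (y + δ) ^ (α - 1) / Real.Gamma α) y

lemma measurable_diffKern (α δ : ℝ) : Measurable (diffKern α δ) := by
  refine (measurable_kern α).sub (Measurable.indicator ?_ measurableSet_Ioc)
  fun_prop

lemma diffKern_nonneg {α δ : ℝ} (hα : 0 < α) (hα1 : α ≤ 1) (hδ : 0 < δ) (y : ℝ) :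
    0 ≤ diffKern α δ y := by
  unfold diffKern
  by_cases h : y ∈ Ioc δ 1
  · have hy : 0 < y := hδ.trans h.1
    rw [indicator_of_mem h, kern, if_pos ⟨hy, h.2⟩, sub_nonneg]
    refine div_le_div_of_nonneg_right ?_ (Real.Gamma_pos_of_pos hα).le
    exact Real.rpow_le_rpow_of_nonpos hy (by linarith) (by linarith)
  · rw [indicator_of_notMem h, sub_zero]
    exact kern_nonneg hα y

lemma integral_kern {α : ℝ} (hα : 0 < α) : ∫ y, kern α y = (α * Real.Gamma α)⁻¹ := by
  have : kern α = (Ioc 0 1).indicator fun y : ℝ => y ^ (α - 1) / Real.Gamma α := by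
    ext y
    simp only [indicator, mem_Ioc, kern]
  rw [this, integral_indicator measurableSet_Ioc, ← intervalIntegral.integral_of_le zero_le_one,
    intervalIntegral.integral_div, integral_rpow (Or.inl (by linarith))]
  have : α ≠ 0 := hα.ne'
  simp [this]
  field_simp

lemma lintegral_diffKern_le {α δ : ℝ} (hα : 0 < α) (hα1 : α ≤ 1) (hδ : 0 < δ) (hδ1 : δ ≤ 1) :
    ∫⁻ y, ENNReal.ofReal (diffKern α δ y) ≤
      ENNReal.ofReal (2 ^ α / (α * Real.Gamma α) * δ ^ α) := by
  have hG := Real.Gamma_pos_of_pos hα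
  have hgi : IntegrableOn (fun y : ℝ => (y + δ) ^ (α - 1) / Real.Gamma α) (Ioc δ 1) := by
    rw [← intervalIntegrable_iff_integrableOn_Ioc_of_le hδ1]
    refine IntervalIntegrable.div_const ?_ _
    apply ContinuousOn.intervalIntegrable
    rw [uIcc_of_le hδ1]
    intro y hy
    refine ContinuousAt.continuousWithinAt ?_
    exact ContinuousAt.rpow_const (by fun_prop) (Or.inl (by linarith [hy.1]))
  have hi : Integrable (diffKern α δ) :=
    (integrable_kern hα).sub (hgi.integrable_indicator measurableSet_Ioc)
  rw [← ofReal_integral_eq_lintegral_ofReal hi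
    (Eventually.of_forall (diffKern_nonneg hα hα1 hδ))]
  refine ENNReal.ofReal_le_ofReal ?_
  unfold diffKern
  rw [integral_sub (integrable_kern hα) (hgi.integrable_indicator measurableSet_Ioc),
    integral_kern hα, integral_indicator measurableSet_Ioc,
    ← intervalIntegral.integral_of_le hδ1, intervalIntegral.integral_div,
    intervalIntegral.integral_comp_add_right (fun y => y ^ (α - 1)) δ,
    integral_rpow (Or.inl (by linarith))]
  have h1 : 1 ≤ (1 + δ) ^ α := Real.one_le_rpow (by linarith) hα.le
  have h2 : (δ + δ) ^ α = 2 ^ α * δ ^ α := by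
    rw [← two_mul, Real.mul_rpow (by norm_num) hδ.le]
  rw [sub_add_cancel, h2]
  have : (α * Real.Gamma α)⁻¹ - ((1 + δ) ^ α - 2 ^ α * δ ^ α) / α / Real.Gamma α =
    2 ^ α / (α * Real.Gamma α) * δ ^ α - ((1 + δ) ^ α - 1) / (α * Real.Gamma α) := by
    field_simp
    ring
  rw [this]
  have : 0 ≤ ((1 + δ) ^ α - 1) / (α * Real.Gamma α) := div_nonneg (by linarith) (by positivity)
  linarith

lemma kern_sub_cell_bounds {α δ a t x : ℝ} (hα : 0 < α) (hα1 : α ≤ 1) (hδ : 0 < δ)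
    (hat : a ≤ t) (hta : t < a + δ) (hx : 0 ≤ x) (ht : t ≤ 1) :
    0 ≤ kern α (t - x) - (if x < a then (a + δ - x) ^ (α - 1) / Real.Gamma α else 0) ∧
    kern α (t - x) - (if x < a then (a + δ - x) ^ (α - 1) / Real.Gamma α else 0) ≤
      diffKern α δ (t - x) := by
  have hG := Real.Gamma_pos_of_pos hα
  split_ifs with hxa
  · have h0 : 0 < t - x := by linarith
    rw [diffKern]
    constructor
    · rw [kern, if_pos ⟨h0, by linarith⟩, sub_nonneg]
      refine div_le_div_of_nonneg_right ?_ hG.le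
      exact Real.rpow_le_rpow_of_nonpos h0 (by linarith) (by linarith)
    · refine sub_le_sub_left ?_ _
      by_cases h : t - x ∈ Ioc δ 1
      · rw [indicator_of_mem h]
        refine div_le_div_of_nonneg_right ?_ hG.le
        exact Real.rpow_le_rpow_of_nonpos (by linarith) (by linarith) (by linarith)
      · rw [indicator_of_notMem h]
        exact div_nonneg (Real.rpow_nonneg (by linarith) _) hG.le
  · rw [sub_zero]
    refine ⟨kern_nonneg hα _, ?_⟩
    rw [diffKern, indicator_of_notMem (by intro h; linarith [h.1]), sub_zero]

lemma enorm_RL_sub_coef_le {α : ℝ} (hα : 0 < α) (hα1 : α ≤ 1) {f : ℝ → ℝ}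
    (hf : Integrable f unitVol) {N : ℕ} (hN : 1 ≤ N) :
    ∀ᵐ t ∂unitVol, ‖RL α f t - coef α f N ⌊N * t⌋₊‖ₑ ≤
      ∫⁻ x, ENNReal.ofReal (diffKern α (1 / N) (t - x)) * ‖f x‖ₑ ∂unitVol := by
  filter_upwards [ae_integrable_kern_mul hα hf, ae_restrict_mem measurableSet_Icc] with t hft ht
  have hmem : ∀ᵐ x ∂unitVol, x ∈ Icc (0:ℝ) 1 := ae_restrict_mem measurableSet_Icc
  have hN0 : (0:ℝ) < N := by exact_mod_cast hN
  have hδ : (0:ℝ) < 1 / N := by positivity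
  set j := ⌊N * t⌋₊ with hj
  have hj1 : (j:ℝ) / N ≤ t := by
    rw [div_le_iff₀ hN0, mul_comm]
    exact Nat.floor_le (mul_nonneg hN0.le ht.1)
  have hj2 : t < j / N + 1 / N := by
    rw [← add_div, lt_div_iff₀ hN0, mul_comm]
    exact Nat.lt_floor_add_one _
  have hb := fun x (hx : 0 ≤ x) => kern_sub_cell_bounds hα hα1 hδ hj1 hj2 hx ht.2
  have hcoef : coef α f N j = ∫ x : ℝ, (if x < j / N then
      (j / N + 1 / N - x) ^ (α - 1) / Real.Gamma α else 0) * f x ∂unitVol := by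
    simp only [coef, add_div]
  have hgi : Integrable (fun x : ℝ => (if x < j / N then
      ((j:ℝ) / N + 1 / N - x) ^ (α - 1) / Real.Gamma α else 0) * f x) unitVol := by
    refine hft.mono ?_ ?_
    · refine (Measurable.aestronglyMeasurable ?_).mul hf.1
      exact Measurable.ite measurableSet_Iio (by fun_prop) (by fun_prop)
    · filter_upwards [hmem] with x hx
      rw [norm_mul, norm_mul]
      refine mul_le_mul_of_nonneg_right ?_ (norm_nonneg _)
      rw [Real.norm_of_nonneg (kern_nonneg hα _), Real.norm_of_nonneg]
      · linarith [(hb x hx.1).1]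
      · split_ifs with h
        · exact div_nonneg (Real.rpow_nonneg (by linarith) _) (Real.Gamma_pos_of_pos hα).le
        · exact le_rfl
  rw [hcoef, RL, ← integral_sub hft hgi]
  refine (enorm_integral_le_lintegral_enorm _).trans (lintegral_mono_ae ?_)
  filter_upwards [hmem] with x hx
  rw [← sub_mul, enorm_mul]
  refine mul_le_mul' ?_ le_rfl
  rw [Real.enorm_of_nonneg (hb x hx.1).1]
  exact ENNReal.ofReal_le_ofReal (hb x hx.1).2

/-- The step approximation of `RL α f` on `N` cells has `L_p` error of order `N^(-α)`. -/
lemma eLpNorm_RL_sub_coef_le {α : ℝ} (hα : 0 < α) (hα1 : α ≤ 1) {f : ℝ → ℝ} {p : ℝ} (hp : 1 ≤ p)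
    (hf : MemLp f (ENNReal.ofReal p) unitVol) {N : ℕ} (hN : 1 ≤ N) :
    eLpNorm (fun t => RL α f t - coef α f N ⌊N * t⌋₊) (ENNReal.ofReal p) unitVol ≤
      ENNReal.ofReal (2 ^ α / (α * Real.Gamma α) * (N:ℝ) ^ (-α)) *
        eLpNorm f (ENNReal.ofReal p) unitVol := by
  have hN1 : (1:ℝ) ≤ N := by exact_mod_cast hN
  refine (eLpNorm_young (measurable_diffKern α (1 / N)).ennreal_ofReal hf.1 hp
    (enorm_RL_sub_coef_le hα hα1 (hf.integrable (by simpa using hp)) hN)).trans ?_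
  refine mul_le_mul' ?_ le_rfl
  refine (lintegral_diffKern_le hα hα1 (by positivity)
    (by rw [div_le_one (by positivity)]; exact hN1)).trans (le_of_eq ?_)
  rw [one_div, Real.inv_rpow (by positivity), Real.rpow_neg (by positivity)]

lemma coef_one_zero (α : ℝ) (f : ℝ → ℝ) : coef α f 1 0 = 0 := by
  rw [coef]
  refine integral_eq_zero_of_ae ?_
  filter_upwards [ae_restrict_mem measurableSet_Icc] with x hx
  have : ¬ x < 0 := not_lt.2 hx.1
  simp [this]

/-- Integer vectors of length `N` with `ℓ₁` norm at most `M`. -/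
noncomputable def latticeBall (N M : ℕ) : Finset (Fin N → ℤ) :=
  (Fintype.piFinset fun _ => Finset.Icc (-(M:ℤ)) M).filter fun m => ∑ j, (m j).natAbs ≤ M

lemma mem_latticeBall {N M : ℕ} {m : Fin N → ℤ} :
    m ∈ latticeBall N M ↔ ∑ j, (m j).natAbs ≤ M := by
  rw [latticeBall, Finset.mem_filter, Fintype.mem_piFinset, and_iff_right_iff_imp]
  intro h j
  have := (Finset.single_le_sum (f := fun j => (m j).natAbs) (by simp) (Finset.mem_univ j)).trans h
  rw [Finset.mem_Icc]
  constructor <;> omega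

lemma sum_pow_natAbs_le (M : ℕ) {x : ℝ} (hx : 0 ≤ x) (hx1 : x < 1) :
    ∑ z ∈ Finset.Icc (-(M:ℤ)) M, x ^ z.natAbs ≤ (1 + x) / (1 - x) := by
  have hx1' : 0 < 1 - x := by linarith
  have key : ∀ M : ℕ, ∑ z ∈ Finset.Icc (-(M:ℤ)) M, x ^ z.natAbs =
      (1 + x - 2 * x ^ (M + 1)) / (1 - x) := by
    intro M
    induction M with
    | zero => simp; field_simp; ring
    | succ M ih =>
      have : Finset.Icc (-((M + 1 : ℕ):ℤ)) (M + 1 : ℕ) =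
          insert (-((M + 1 : ℕ):ℤ)) (insert ((M + 1 : ℕ):ℤ) (Finset.Icc (-(M:ℤ)) M)) := by
        ext z
        simp only [Finset.mem_insert, Finset.mem_Icc]
        omega
      rw [this, Finset.sum_insert, Finset.sum_insert, ih, Int.natAbs_neg, Int.natAbs_natCast]
      · field_simp
        ring
      · simp
      · simp only [Finset.mem_insert, Finset.mem_Icc]
        omega
  rw [key]
  refine div_le_div_of_nonneg_right ?_ hx1'.le
  linarith [pow_nonneg hx (M + 1)]

lemma card_latticeBall_mul_le (N M : ℕ) {x : ℝ} (hx : 0 ≤ x) (hx1 : x < 1) :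
    (latticeBall N M).card * x ^ M ≤ ((1 + x) / (1 - x)) ^ N := by
  calc ((latticeBall N M).card : ℝ) * x ^ M = ∑ _m ∈ latticeBall N M, x ^ M := by
        rw [Finset.sum_const, nsmul_eq_mul]
    _ ≤ ∑ m ∈ latticeBall N M, ∏ j, x ^ (m j).natAbs := by
        refine Finset.sum_le_sum fun m hm => ?_
        rw [Finset.prod_pow_eq_pow_sum]
        exact pow_le_pow_of_le_one hx hx1.le (mem_latticeBall.1 hm)
    _ ≤ ∑ m ∈ Fintype.piFinset fun _ : Fin N => Finset.Icc (-(M:ℤ)) M,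
          ∏ j, x ^ (m j).natAbs := by
        refine Finset.sum_le_sum_of_subset_of_nonneg (Finset.filter_subset _ _) ?_
        intro m _ _
        exact Finset.prod_nonneg fun j _ => pow_nonneg hx _
    _ = ∏ _j : Fin N, ∑ z ∈ Finset.Icc (-(M:ℤ)) M, x ^ z.natAbs := by
        rw [Finset.prod_univ_sum]
    _ ≤ ∏ _j : Fin N, (1 + x) / (1 - x) := by
        refine Finset.prod_le_prod (fun j _ => Finset.sum_nonneg fun z _ => pow_nonneg hx _) ?_
        exact fun j _ => sum_pow_natAbs_le M hx hx1
    _ = _ := by rw [Finset.prod_const, Finset.card_univ, Fintype.card_fin]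

lemma card_latticeBall_le_sparse {N M : ℕ} {s : ℝ} (hs : 0 ≤ s)
    (hM : (M:ℝ) ≤ N * 2 ^ (-s)) :
    ((latticeBall N M).card : ℝ) ≤ 2 ^ (N * 2 ^ (-s) * (s + 4)) := by
  set ρ : ℝ := 2 ^ (-s) with hρ
  have hρ0 : 0 < ρ := by positivity
  have hρ1 : ρ ≤ 1 := Real.rpow_le_one_of_one_le_of_nonpos (by norm_num) (by linarith)
  have h := card_latticeBall_mul_le N M (x := ρ / 2) (by positivity) (by linarith)
  have h1 : (1 + ρ / 2) / (1 - ρ / 2) ≤ 2 ^ (3 * ρ) := by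
    have : (2:ℝ) ^ (3 * ρ) = Real.exp (Real.log 2 * (3 * ρ)) := Real.rpow_def_of_pos (by norm_num) _
    rw [this]
    have h2 : Real.log 2 * (3 * ρ) + 1 ≤ Real.exp (Real.log 2 * (3 * ρ)) := Real.add_one_le_exp _
    have h3 : 0.6931471803 < Real.log 2 := Real.log_two_gt_d9
    refine le_trans ?_ h2
    rw [div_le_iff₀ (by linarith)]
    have h4 : 2 * ρ ≤ Real.log 2 * (3 * ρ) := by nlinarith
    have h5 : (2 * ρ + 1) * (1 - ρ / 2) ≤ (Real.log 2 * (3 * ρ) + 1) * (1 - ρ / 2) :=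
      mul_le_mul_of_nonneg_right (by linarith) (by linarith)
    nlinarith
  have h2 : (2:ℝ) ^ (-(N * ρ * (s + 1))) ≤ (ρ / 2) ^ M := by
    have e : ρ / 2 = 2 ^ (-(s + 1)) := by
      rw [neg_add, Real.rpow_add (by norm_num), ← hρ, Real.rpow_neg_one]; rfl
    rw [e, ← Real.rpow_mul_natCast (by norm_num)]
    refine Real.rpow_le_rpow_of_exponent_le (by norm_num) ?_
    nlinarith
  have h3 : ((1 + ρ / 2) / (1 - ρ / 2)) ^ N ≤ (2:ℝ) ^ (3 * ρ * N) := by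
    rw [Real.rpow_mul_natCast (by norm_num)]
    exact pow_le_pow_left₀ (div_nonneg (by linarith) (by linarith)) h1 N
  have h4 : ((latticeBall N M).card : ℝ) * 2 ^ (-(N * ρ * (s + 1))) ≤ 2 ^ (3 * ρ * N) :=
    (mul_le_mul_of_nonneg_left h2 (by positivity)).trans (h.trans h3)
  rw [Real.rpow_neg (by norm_num), ← div_eq_mul_inv, div_le_iff₀ (by positivity),
    ← Real.rpow_add (by norm_num)] at h4
  refine h4.trans (le_of_eq ?_)
  congr 1
  ring

lemma card_latticeBall_le_dense {N M : ℕ} {s : ℝ} (hs : 0 ≤ s)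
    (hM : (M:ℝ) ≤ N * 2 ^ s) :
    ((latticeBall N M).card : ℝ) ≤ 2 ^ (N * (s + 4)) := by
  set ρ : ℝ := 2 ^ s with hρ
  have hρ1 : 1 ≤ ρ := Real.one_le_rpow (by norm_num) hs
  have hρ0 : 0 < ρ := by positivity
  have hi : 1 / (2 * ρ) ≤ 1 / 2 := by
    rw [div_le_div_iff₀ (by positivity) (by norm_num)]; linarith
  have hi0 : 0 < 1 / (2 * ρ) := by positivity
  set x : ℝ := 1 - 1 / (2 * ρ) with hx
  have hx0 : 0 < x := by linarith
  have h := card_latticeBall_mul_le N M hx0.le (by linarith)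
  have h1 : (1 + x) / (1 - x) ≤ 2 ^ (s + 2) := by
    rw [Real.rpow_add (by norm_num), ← hρ, div_le_iff₀ (by linarith), hx]
    have : ρ * 2 ^ (2:ℝ) * (1 - (1 - 1 / (2 * ρ))) = 2 := by
      norm_num
      field_simp
      norm_num
    linarith
  have h2 : x⁻¹ ≤ Real.exp (1 / ρ) := by
    refine le_trans ?_ (Real.add_one_le_exp _)
    rw [inv_le_iff_one_le_mul₀ hx0, hx]
    have e : (1 / ρ + 1) * (1 - 1 / (2 * ρ)) = 1 + (ρ - 1) / (2 * ρ ^ 2) := by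
      field_simp
      ring
    rw [e]
    have : 0 ≤ (ρ - 1) / (2 * ρ ^ 2) := div_nonneg (by linarith) (by positivity)
    linarith
  have h3 : (x⁻¹) ^ M ≤ 2 ^ (2 * (N:ℝ)) := by
    calc (x⁻¹) ^ M ≤ Real.exp (1 / ρ) ^ M := pow_le_pow_left₀ (by positivity) h2 M
      _ = Real.exp (M / ρ) := by rw [← Real.exp_nat_mul]; congr 1; ring
      _ ≤ Real.exp N := Real.exp_le_exp.2 (by rw [div_le_iff₀ hρ0]; exact hM)
      _ ≤ Real.exp (Real.log 2 * (2 * N)) := by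
          refine Real.exp_le_exp.2 ?_
          have h3 : 0.6931471803 < Real.log 2 := Real.log_two_gt_d9
          have : (0:ℝ) ≤ N := by positivity
          nlinarith
      _ = _ := (Real.rpow_def_of_pos (by norm_num) _).symm
  calc ((latticeBall N M).card : ℝ) = (latticeBall N M).card * x ^ M * (x⁻¹) ^ M := by
        rw [mul_assoc, ← mul_pow, mul_inv_cancel₀ hx0.ne', one_pow, mul_one]
    _ ≤ ((1 + x) / (1 - x)) ^ N * 2 ^ (2 * (N:ℝ)) := by
        refine mul_le_mul h h3 (by positivity) ?_
        exact pow_nonneg (div_nonneg (by linarith) (by linarith)) _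
    _ ≤ (2 ^ (s + 2)) ^ N * 2 ^ (2 * (N:ℝ)) := by
        refine mul_le_mul_of_nonneg_right ?_ (by positivity)
        exact pow_le_pow_left₀ (div_nonneg (by linarith) (by linarith)) h1 N
    _ = _ := by
        rw [← Real.rpow_mul_natCast (by norm_num), ← Real.rpow_add (by norm_num)]
        congr 1
        ring

/-- Rounding towards zero. -/
noncomputable def truncInt (z : ℝ) : ℤ := if 0 ≤ z then ⌊z⌋ else ⌈z⌉

lemma natAbs_truncInt_le (z : ℝ) : ((truncInt z).natAbs : ℝ) ≤ |z| := by
  rw [Nat.cast_natAbs, Int.cast_abs, truncInt]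
  split_ifs with h
  · have : (0:ℝ) ≤ (⌊z⌋ : ℤ) := by exact_mod_cast Int.floor_nonneg.2 h
    rw [abs_of_nonneg this, abs_of_nonneg h]
    exact Int.floor_le z
  · push Not at h
    have : ((⌈z⌉ : ℤ) : ℝ) ≤ 0 := by exact_mod_cast Int.ceil_le.2 (by exact_mod_cast h.le)
    rw [abs_of_nonpos this, abs_of_neg h]
    linarith [Int.le_ceil z]

lemma abs_sub_truncInt_le (z : ℝ) : |z - truncInt z| ≤ |z| ∧ |z - truncInt z| ≤ 1 := by
  rw [truncInt]
  split_ifs with h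
  · have : (0:ℝ) ≤ (⌊z⌋ : ℤ) := by exact_mod_cast Int.floor_nonneg.2 h
    have h1 := Int.floor_le z
    have h2 := Int.lt_floor_add_one z
    rw [abs_of_nonneg h, abs_of_nonneg (by linarith)]
    constructor <;> linarith
  · push Not at h
    have : ((⌈z⌉ : ℤ) : ℝ) ≤ 0 := by exact_mod_cast Int.ceil_le.2 (by exact_mod_cast h.le)
    have h1 := Int.le_ceil z
    have h2 := Int.ceil_lt_add_one z
    rw [abs_of_neg h, abs_of_nonpos (by linarith)]
    constructor <;> linarith

lemma floor_mul_eq {N j : ℕ} (hN : 1 ≤ N) {t : ℝ} (ht : t ∈ Ico ((j:ℝ) / N) ((j + 1) / N)) :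
    ⌊N * t⌋₊ = j := by
  have hN0 : (0:ℝ) < N := by exact_mod_cast hN
  have h1 := (div_le_iff₀ hN0).1 ht.1
  have h2 := (lt_div_iff₀ hN0).1 ht.2
  rw [Nat.floor_eq_iff (by rw [mul_comm]; exact le_trans (by positivity) h1)]
  constructor <;> linarith

lemma pairwiseDisjoint_cells (N : ℕ) (s : Set ℕ) :
    s.PairwiseDisjoint fun j : ℕ => Ico ((j:ℝ) / N) ((j + 1) / N) := by
  intro i _ j _ hij
  rcases Nat.eq_zero_or_pos N with rfl | hN
  · simp [Function.onFun]
  refine Set.disjoint_left.2 fun t hi hj => hij ?_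
  rw [← floor_mul_eq hN hi, ← floor_mul_eq hN hj]

lemma sum_lintegral_cells_le {N : ℕ} (hN : 1 ≤ N) (g : ℝ → ℝ≥0∞) :
    ∑ j ∈ Finset.range N, ∫⁻ t in Ico ((j:ℝ) / N) ((j + 1) / N), g t ≤ ∫⁻ t, g t ∂unitVol := by
  have hN0 : (0:ℝ) < N := by exact_mod_cast hN
  rw [← lintegral_biUnion_finset (pairwiseDisjoint_cells N _) (fun _ _ => measurableSet_Ico)]
  refine lintegral_mono_set ?_
  refine iUnion₂_subset fun j hj t ht => ?_
  rw [Finset.mem_range] at hj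
  have h0 : (0:ℝ) ≤ j / N := by positivity
  have h1 : ((j:ℝ) + 1) / N ≤ 1 := by
    rw [div_le_one hN0]
    exact_mod_cast hj
  exact ⟨h0.trans ht.1, ht.2.le.trans h1⟩

lemma sum_le_lintegral_step {N : ℕ} (hN : 1 ≤ N) (g : ℕ → ℝ≥0∞) :
    ∑ j ∈ Finset.range N, g j ≤ N * ∫⁻ t, g ⌊N * t⌋₊ ∂unitVol := by
  have hN0 : (0:ℝ) < N := by exact_mod_cast hN
  have h := sum_lintegral_cells_le hN fun t => g ⌊N * t⌋₊
  calc _ = N * ∑ j ∈ Finset.range N, ∫⁻ t in Ico ((j:ℝ) / N) ((j + 1) / N), g ⌊N * t⌋₊ := by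
        rw [Finset.mul_sum]
        refine Finset.sum_congr rfl fun j _ => ?_
        rw [setLIntegral_congr_fun (g := fun _ => g j) measurableSet_Ico
          (fun t ht => by simp only [floor_mul_eq hN ht]), setLIntegral_const, Real.volume_Ico,
          mul_comm, mul_assoc]
        have : ((j:ℝ) + 1) / N - j / N = (N:ℝ)⁻¹ := by field_simp; ring
        rw [this, ENNReal.ofReal_inv_of_pos hN0, ENNReal.ofReal_natCast,
          ENNReal.inv_mul_cancel (by simpa using hN0.ne') (by simp), mul_one]
    _ ≤ _ := by gcongr

lemma measurable_step {β : Type*} [MeasurableSpace β] (N : ℕ) (c : ℕ → β) :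
    Measurable fun t : ℝ => c ⌊N * t⌋₊ :=
  (measurable_from_nat (f := c)).comp (Nat.measurable_floor.comp (measurable_const_mul _))

lemma sum_rpow_le_of_eLpNorm_step {N : ℕ} (hN : 1 ≤ N) {c : ℕ → ℝ} {p B : ℝ} (hp : 1 ≤ p)
    (hB : 0 ≤ B)
    (h : eLpNorm (fun t : ℝ => c ⌊N * t⌋₊) (ENNReal.ofReal p) unitVol ≤ ENNReal.ofReal B) :
    ∑ j ∈ Finset.range N, |c j| ^ p ≤ N * B ^ p := by
  have hp0 : 0 < p := by linarith
  rw [eLpNorm_eq_lintegral_rpow_enorm_toReal (by simpa using hp0) (by simp),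
    ENNReal.toReal_ofReal hp0.le] at h
  have h2 := ENNReal.rpow_le_rpow h hp0.le
  rw [← ENNReal.rpow_mul, one_div_mul_cancel hp0.ne', ENNReal.rpow_one,
    ENNReal.ofReal_rpow_of_nonneg hB hp0.le] at h2
  have h3 := (sum_le_lintegral_step hN fun j => ‖c j‖ₑ ^ p).trans (mul_le_mul' le_rfl h2)
  have h4 : ∑ j ∈ Finset.range N, ‖c j‖ₑ ^ p =
      ENNReal.ofReal (∑ j ∈ Finset.range N, |c j| ^ p) := by
    rw [ENNReal.ofReal_sum_of_nonneg (fun j _ => by positivity)]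
    refine Finset.sum_congr rfl fun j _ => ?_
    rw [Real.enorm_eq_ofReal_abs, ENNReal.ofReal_rpow_of_nonneg (abs_nonneg _) hp0.le]
  rw [h4, ← ENNReal.ofReal_natCast, ← ENNReal.ofReal_mul (by positivity)] at h3
  exact (ENNReal.ofReal_le_ofReal_iff (by positivity)).1 h3

/-- Interpolation between `L_∞` and `L_p`. -/
lemma eLpNorm_le_interp {g w : ℝ → ℝ} {p τ B : ℝ} {q : ℝ≥0∞} (hp : 1 ≤ p)
    (hpq : ENNReal.ofReal p ≤ q) (hτ : 0 < τ) (hB : 0 < B)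
    (hgτ : ∀ᵐ t ∂unitVol, |g t| ≤ τ) (hgw : ∀ᵐ t ∂unitVol, |g t| ≤ |w t|)
    (hw : eLpNorm w (ENNReal.ofReal p) unitVol ≤ ENNReal.ofReal B) :
    eLpNorm g q unitVol ≤
      ENNReal.ofReal (τ ^ (p * (p⁻¹ - q⁻¹.toReal)) * B ^ (1 - p * (p⁻¹ - q⁻¹.toReal))) := by
  have hp0 : 0 < p := by linarith
  rcases eq_or_ne q ⊤ with rfl | hq
  · simp only [ENNReal.inv_top, ENNReal.toReal_zero, sub_zero, mul_inv_cancel₀ hp0.ne', sub_self,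
      Real.rpow_one, Real.rpow_zero, mul_one]
    refine (eLpNorm_le_of_ae_bound (C := τ) ?_).trans (by simp)
    simpa using hgτ
  lift q to ℝ≥0 using hq
  have hpr : p ≤ q := by
    have := ENNReal.toReal_mono (by simp) hpq
    rwa [ENNReal.toReal_ofReal hp0.le] at this
  set r : ℝ := (q:ℝ) with hr
  have hr0 : 0 < r := by linarith
  have hq0 : (q:ℝ≥0∞) ≠ 0 := by
    intro h
    have : q = 0 := by exact_mod_cast h
    rw [this] at hr
    simp at hr
    linarith
  rw [eLpNorm_eq_lintegral_rpow_enorm_toReal (by simpa using hp0) (by simp),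
    ENNReal.toReal_ofReal hp0.le] at hw
  have h2 := ENNReal.rpow_le_rpow hw hp0.le
  rw [← ENNReal.rpow_mul, one_div_mul_cancel hp0.ne', ENNReal.rpow_one,
    ENNReal.ofReal_rpow_of_pos hB] at h2
  rw [eLpNorm_eq_lintegral_rpow_enorm_toReal hq0 (by simp), ENNReal.coe_toReal]
  have h3 : ∫⁻ t, ‖g t‖ₑ ^ r ∂unitVol ≤ ENNReal.ofReal (τ ^ (r - p) * B ^ p) := by
    calc _ ≤ ∫⁻ t, ENNReal.ofReal (τ ^ (r - p)) * ‖w t‖ₑ ^ p ∂unitVol := by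
          refine lintegral_mono_ae ?_
          filter_upwards [hgτ, hgw] with t h1 h2
          rw [Real.enorm_eq_ofReal_abs, Real.enorm_eq_ofReal_abs,
            ENNReal.ofReal_rpow_of_nonneg (abs_nonneg _) hr0.le,
            ENNReal.ofReal_rpow_of_nonneg (abs_nonneg _) hp0.le,
            ← ENNReal.ofReal_mul (by positivity)]
          refine ENNReal.ofReal_le_ofReal ?_
          have e : |g t| ^ r = |g t| ^ (r - p) * |g t| ^ p := by
            rw [← Real.rpow_add_of_nonneg (abs_nonneg _) (by linarith) hp0.le]
            congr 1
            ring
          rw [e]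
          exact mul_le_mul (Real.rpow_le_rpow (abs_nonneg _) h1 (by linarith))
            (Real.rpow_le_rpow (abs_nonneg _) h2 hp0.le) (by positivity) (by positivity)
      _ = ENNReal.ofReal (τ ^ (r - p)) * ∫⁻ t, ‖w t‖ₑ ^ p ∂unitVol :=
          lintegral_const_mul' _ _ (by simp)
      _ ≤ _ := by
          rw [ENNReal.ofReal_mul (by positivity)]
          exact mul_le_mul' le_rfl h2
  refine (ENNReal.rpow_le_rpow h3 (by positivity)).trans (le_of_eq ?_)
  rw [ENNReal.ofReal_rpow_of_pos (by positivity), Real.mul_rpow (by positivity) (by positivity),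
    ← Real.rpow_mul hτ.le, ← Real.rpow_mul hB.le, ENNReal.toReal_inv, ENNReal.coe_toReal, ← hr]
  have e1 : (r - p) * (1 / r) = p * (p⁻¹ - r⁻¹) := by field_simp
  have e2 : p * (1 / r) = 1 - p * (p⁻¹ - r⁻¹) := by field_simp; ring
  rw [e1, e2]

/-- The step function with values `τ * m j` on the `N` cells. -/
noncomputable def latticeStep (N : ℕ) (τ : ℝ) (m : Fin N → ℤ) (t : ℝ) : ℝ :=
  if h : ⌊N * t⌋₊ < N then τ * m ⟨_, h⟩ else 0

lemma measurable_latticeStep (N : ℕ) (τ : ℝ) (m : Fin N → ℤ) :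
    Measurable (latticeStep N τ m) :=
  measurable_step N fun j => if h : j < N then τ * m ⟨j, h⟩ else 0

lemma memLp_latticeStep (N : ℕ) (τ : ℝ) (m : Fin N → ℤ) (q : ℝ≥0∞) :
    MemLp (latticeStep N τ m) q unitVol := by
  refine MemLp.of_bound (measurable_latticeStep N τ m).aestronglyMeasurable
    (∑ j, |τ * m j|) (Eventually.of_forall fun t => ?_)
  rw [latticeStep, Real.norm_eq_abs]
  split_ifs with h
  · exact Finset.single_le_sum (f := fun j => |τ * m j|) (fun _ _ => abs_nonneg _)
      (Finset.mem_univ (⟨_, h⟩ : Fin N))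
  · simp only [abs_zero]
    exact Finset.sum_nonneg fun _ _ => abs_nonneg _

/-- Quantization of the step functions with bounded `L_p` norm. -/
lemma exists_latticeStep_near {N : ℕ} (hN : 1 ≤ N) {c : ℕ → ℝ} {p B τ : ℝ} (hp : 1 ≤ p)
    (hB : 0 < B) (hτ : 0 < τ) {q : ℝ≥0∞} (hpq : ENNReal.ofReal p ≤ q)
    (h : eLpNorm (fun t : ℝ => c ⌊N * t⌋₊) (ENNReal.ofReal p) unitVol ≤ ENNReal.ofReal B) :
    ∃ m ∈ latticeBall N ⌊N * (B / τ) ^ p⌋₊,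
      eLpNorm (fun t : ℝ => c ⌊N * t⌋₊ - latticeStep N τ m t) q unitVol ≤
        ENNReal.ofReal (τ ^ (p * (p⁻¹ - q⁻¹.toReal)) * B ^ (1 - p * (p⁻¹ - q⁻¹.toReal))) ∧
      eLpNorm (fun t : ℝ => c ⌊N * t⌋₊ - latticeStep N τ m t) q unitVol ≤ ENNReal.ofReal τ := by
  have hp0 : 0 < p := by linarith
  have hN0 : (0:ℝ) < N := by exact_mod_cast hN
  have hb : ∀ᵐ t : ℝ ∂unitVol,
      |c ⌊N * t⌋₊ - latticeStep N τ (fun j => truncInt (c j / τ)) t| ≤ |c ⌊N * t⌋₊| ∧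
      |c ⌊N * t⌋₊ - latticeStep N τ (fun j => truncInt (c j / τ)) t| ≤ τ := by
    have h1 : ∀ᵐ t ∂unitVol, t ∈ Ico (0:ℝ) 1 := by
      rw [unitVol, ← restrict_Ico_eq_restrict_Icc]
      exact ae_restrict_mem measurableSet_Ico
    filter_upwards [h1] with t ht
    have hlt : ⌊N * t⌋₊ < N := by
      rw [Nat.floor_lt (mul_nonneg hN0.le ht.1)]
      nlinarith [ht.2]
    rw [latticeStep, dif_pos hlt]
    set z := c ⌊N * t⌋₊ with hz
    have e : z - τ * truncInt (z / τ) = τ * (z / τ - truncInt (z / τ)) := by field_simp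
    have e2 : |z| = τ * |z / τ| := by
      rw [abs_div, abs_of_pos hτ]; field_simp
    obtain ⟨h1, h2⟩ := abs_sub_truncInt_le (z / τ)
    rw [e, abs_mul, abs_of_pos hτ, e2]
    constructor <;> nlinarith
  refine ⟨fun j => truncInt (c j / τ), ?_, ?_, ?_⟩
  · rw [mem_latticeBall, Nat.le_floor_iff (by positivity), Nat.cast_sum]
    have hs := sum_rpow_le_of_eLpNorm_step hN hp hB.le h
    calc ∑ j : Fin N, ((truncInt (c j / τ)).natAbs : ℝ)
        ≤ ∑ j : Fin N, (|c j| ^ p / τ ^ p) := by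
          refine Finset.sum_le_sum fun j _ => ?_
          have h1 := natAbs_truncInt_le (c j / τ)
          rw [abs_div, abs_of_pos hτ] at h1
          rw [← Real.div_rpow (abs_nonneg _) hτ.le]
          rcases Nat.eq_zero_or_pos (truncInt (c j / τ)).natAbs with h0 | h0
          · rw [h0, Nat.cast_zero]
            positivity
          · have h2 : (1:ℝ) ≤ (truncInt (c j / τ)).natAbs := by exact_mod_cast h0
            refine h1.trans ?_
            exact Real.self_le_rpow_of_one_le (h2.trans h1) hp
      _ = (∑ j ∈ Finset.range N, |c j| ^ p) / τ ^ p := by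
          rw [Finset.sum_div, Finset.sum_range]
      _ ≤ N * B ^ p / τ ^ p := by gcongr
      _ = _ := by rw [Real.div_rpow hB.le hτ.le, mul_div_assoc]
  · exact eLpNorm_le_interp hp hpq hτ hB (hb.mono fun t ht => ht.2) (hb.mono fun t ht => ht.1) h
  · refine (eLpNorm_le_of_ae_bound (C := τ) (hb.mono fun t ht => ht.2)).trans (by simp)

/-- Covering of the step functions bounded in `L_p`, with few balls of large radius in `L_q`. -/
lemma exists_cover_sparse {N : ℕ} (hN : 1 ≤ N) {p B s : ℝ} (hp : 1 ≤ p) (hB : 0 < B)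
    (hs : 0 ≤ s) {q : ℝ≥0∞} (hpq : ENNReal.ofReal p ≤ q) :
    ∃ S : Finset (ℝ → ℝ), (S.card : ℝ) ≤ 2 ^ (N * 2 ^ (-s) * (s + 4)) ∧
      (∀ h ∈ S, MemLp h q unitVol) ∧ ∀ c : ℕ → ℝ,
        eLpNorm (fun t : ℝ => c ⌊N * t⌋₊) (ENNReal.ofReal p) unitVol ≤ ENNReal.ofReal B →
        ∃ h ∈ S, eLpNorm (fun t : ℝ => c ⌊N * t⌋₊ - h t) q unitVol ≤
          ENNReal.ofReal (B * 2 ^ ((p⁻¹ - q⁻¹.toReal) * s)) := by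
  classical
  have hp0 : 0 < p := by linarith
  set τ : ℝ := B * 2 ^ (s / p) with hτ
  have hτ0 : 0 < τ := by positivity
  have e1 : (B / τ) ^ p = 2 ^ (-s) := by
    have : B / τ = 2 ^ (-(s / p)) := by
      rw [hτ, Real.rpow_neg (by norm_num)]; field_simp
    rw [this, ← Real.rpow_mul (by norm_num)]
    congr 1
    field_simp
  have e2 : τ ^ (p * (p⁻¹ - q⁻¹.toReal)) * B ^ (1 - p * (p⁻¹ - q⁻¹.toReal)) =
      B * 2 ^ ((p⁻¹ - q⁻¹.toReal) * s) := by
    rw [hτ, Real.mul_rpow hB.le (by positivity), mul_right_comm, ← Real.rpow_add hB,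
      ← Real.rpow_mul (by norm_num), add_sub_cancel, Real.rpow_one]
    congr 2
    field_simp
  refine ⟨(latticeBall N ⌊N * (B / τ) ^ p⌋₊).image (latticeStep N τ), ?_, ?_, ?_⟩
  · refine le_trans (Nat.cast_le.2 Finset.card_image_le) (card_latticeBall_le_sparse hs ?_)
    rw [e1]
    exact Nat.floor_le (by positivity)
  · intro h hh
    obtain ⟨m, -, rfl⟩ := Finset.mem_image.1 hh
    exact memLp_latticeStep N τ m q
  · intro c hc
    obtain ⟨m, hm, h1, -⟩ := exists_latticeStep_near hN hp hB hτ0 hpq hc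
    exact ⟨_, Finset.mem_image_of_mem _ hm, h1.trans_eq (by rw [e2])⟩

/-- Covering of the step functions bounded in `L_p`, with many balls of small radius in `L_q`. -/
lemma exists_cover_dense {N : ℕ} (hN : 1 ≤ N) {p B s : ℝ} (hp : 1 ≤ p) (hB : 0 < B)
    (hs : 0 ≤ s) {q : ℝ≥0∞} (hpq : ENNReal.ofReal p ≤ q) :
    ∃ S : Finset (ℝ → ℝ), (S.card : ℝ) ≤ 2 ^ (N * (s + 4)) ∧
      (∀ h ∈ S, MemLp h q unitVol) ∧ ∀ c : ℕ → ℝ,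
        eLpNorm (fun t : ℝ => c ⌊N * t⌋₊) (ENNReal.ofReal p) unitVol ≤ ENNReal.ofReal B →
        ∃ h ∈ S, eLpNorm (fun t : ℝ => c ⌊N * t⌋₊ - h t) q unitVol ≤
          ENNReal.ofReal (B * 2 ^ (-(s / p))) := by
  classical
  have hp0 : 0 < p := by linarith
  set τ : ℝ := B * 2 ^ (-(s / p)) with hτ
  have hτ0 : 0 < τ := by positivity
  have e1 : (B / τ) ^ p = 2 ^ s := by
    have : B / τ = 2 ^ (s / p) := by
      rw [hτ, Real.rpow_neg (by norm_num)]; field_simp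
    rw [this, ← Real.rpow_mul (by norm_num)]
    congr 1
    field_simp
  refine ⟨(latticeBall N ⌊N * (B / τ) ^ p⌋₊).image (latticeStep N τ), ?_, ?_, ?_⟩
  · refine le_trans (Nat.cast_le.2 Finset.card_image_le) (card_latticeBall_le_dense hs ?_)
    rw [e1]
    exact Nat.floor_le (by positivity)
  · intro h hh
    obtain ⟨m, -, rfl⟩ := Finset.mem_image.1 hh
    exact memLp_latticeStep N τ m q
  · intro c hc
    obtain ⟨m, hm, -, h1⟩ := exists_latticeStep_near hN hp hB hτ0 hpq hc
    exact ⟨_, Finset.mem_image_of_mem _ hm, h1⟩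

/-- The inverse inequality for step functions. -/
lemma eLpNorm_step_le {N : ℕ} (hN : 1 ≤ N) {c : ℕ → ℝ} {p B : ℝ} (hp : 1 ≤ p)
    (hB : 0 < B) {q : ℝ≥0∞} (hpq : ENNReal.ofReal p ≤ q)
    (h : eLpNorm (fun t : ℝ => c ⌊N * t⌋₊) (ENNReal.ofReal p) unitVol ≤ ENNReal.ofReal B) :
    eLpNorm (fun t : ℝ => c ⌊N * t⌋₊) q unitVol ≤
      ENNReal.ofReal (B * (N:ℝ) ^ (p⁻¹ - q⁻¹.toReal)) := by
  have hp0 : 0 < p := by linarith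
  have hN0 : (0:ℝ) < N := by exact_mod_cast hN
  have hs := sum_rpow_le_of_eLpNorm_step hN hp hB.le h
  have hb : ∀ᵐ t : ℝ ∂unitVol, |c ⌊N * t⌋₊| ≤ B * (N:ℝ) ^ p⁻¹ := by
    have h1 : ∀ᵐ t ∂unitVol, t ∈ Ico (0:ℝ) 1 := by
      rw [unitVol, ← restrict_Ico_eq_restrict_Icc]
      exact ae_restrict_mem measurableSet_Ico
    filter_upwards [h1] with t ht
    have hlt : ⌊N * t⌋₊ < N := by
      rw [Nat.floor_lt (mul_nonneg hN0.le ht.1)]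
      nlinarith [ht.2]
    have h2 := (Finset.single_le_sum (f := fun j => |c j| ^ p) (fun _ _ => by positivity)
      (Finset.mem_range.2 hlt)).trans hs
    rw [← Real.rpow_le_rpow_iff (abs_nonneg _) (by positivity) hp0,
      Real.mul_rpow hB.le (by positivity), ← Real.rpow_mul hN0.le, inv_mul_cancel₀ hp0.ne',
      Real.rpow_one, mul_comm (B ^ p)]
    exact h2
  refine (eLpNorm_le_interp hp hpq (by positivity) hB hb (ae_of_all _ fun _ => le_rfl) h).trans
    (le_of_eq ?_)
  rw [Real.mul_rpow hB.le (by positivity), mul_right_comm, ← Real.rpow_add hB,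
    ← Real.rpow_mul hN0.le, add_sub_cancel, Real.rpow_one]
  congr 3
  field_simp

/-- The step approximation of `RL α f` on the dyadic cells of length `2^(-k)`. -/
noncomputable def dyadicApprox (α : ℝ) (f : ℝ → ℝ) (k : ℕ) (t : ℝ) : ℝ :=
  coef α f (2 ^ k) ⌊((2 ^ k : ℕ) : ℝ) * t⌋₊

lemma measurable_dyadicApprox (α : ℝ) (f : ℝ → ℝ) (k : ℕ) : Measurable (dyadicApprox α f k) :=
  measurable_step _ _

lemma dyadicApprox_zero (α : ℝ) (f : ℝ → ℝ) {t : ℝ} (ht : t ∈ Ico (0:ℝ) 1) :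
    dyadicApprox α f 0 t = 0 := by
  have : ⌊((2 ^ 0 : ℕ) : ℝ) * t⌋₊ = 0 := by
    rw [Nat.floor_eq_zero]
    simpa using ht.2
  rw [dyadicApprox, this, pow_zero, coef_one_zero]

lemma exists_step_dyadicApprox_sub (α : ℝ) (f : ℝ → ℝ) (k : ℕ) : ∃ c : ℕ → ℝ, ∀ t,
    dyadicApprox α f (k + 1) t - dyadicApprox α f k t = c ⌊((2 ^ (k + 1) : ℕ) : ℝ) * t⌋₊ := by
  refine ⟨fun j => coef α f (2 ^ (k + 1)) j - coef α f (2 ^ k) (j / 2), fun t => ?_⟩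
  have : ⌊((2 ^ (k + 1) : ℕ) : ℝ) * t⌋₊ / 2 = ⌊((2 ^ k : ℕ) : ℝ) * t⌋₊ := by
    rw [← Nat.floor_div_natCast]
    congr 1
    push_cast
    ring
  simp only [dyadicApprox, this]

lemma two_pow_rpow_neg (k : ℕ) (α : ℝ) : ((2 ^ k : ℕ) : ℝ) ^ α = 2 ^ (α * k) := by
  push_cast
  rw [← Real.rpow_natCast, ← Real.rpow_mul (by norm_num), mul_comm]

lemma eLpNorm_RL_sub_dyadicApprox_le {α : ℝ} (hα : 0 < α) (hα1 : α ≤ 1) {f : ℝ → ℝ} {p : ℝ}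
    (hp : 1 ≤ p) (hf : MemLp f (ENNReal.ofReal p) unitVol)
    (hf1 : eLpNorm f (ENNReal.ofReal p) unitVol ≤ 1) (k : ℕ) :
    eLpNorm (RL α f - dyadicApprox α f k) (ENNReal.ofReal p) unitVol ≤
      ENNReal.ofReal (2 ^ α / (α * Real.Gamma α) * 2 ^ (-α * k)) := by
  refine (eLpNorm_RL_sub_coef_le hα hα1 hp hf (N := 2 ^ k) Nat.one_le_two_pow).trans ?_
  rw [two_pow_rpow_neg]
  exact (mul_le_mul' le_rfl hf1).trans_eq (mul_one _)

lemma eLpNorm_dyadicApprox_sub_le {α : ℝ} (hα : 0 < α) (hα1 : α ≤ 1) {f : ℝ → ℝ} {p : ℝ}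
    (hp : 1 ≤ p) (hf : MemLp f (ENNReal.ofReal p) unitVol)
    (hf1 : eLpNorm f (ENNReal.ofReal p) unitVol ≤ 1) (k : ℕ) :
    eLpNorm (fun t => dyadicApprox α f (k + 1) t - dyadicApprox α f k t) (ENNReal.ofReal p)
      unitVol ≤ ENNReal.ofReal (2 * (2 ^ α / (α * Real.Gamma α)) * 2 ^ (-α * k)) := by
  have hG := Real.Gamma_pos_of_pos hα
  have e : (fun t => dyadicApprox α f (k + 1) t - dyadicApprox α f k t) =
      (RL α f - dyadicApprox α f k) - (RL α f - dyadicApprox α f (k + 1)) := by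
    ext t
    simp
  have hm := fun k => (aestronglyMeasurable_RL α hf.1).sub
    (measurable_dyadicApprox α f k).aestronglyMeasurable
  rw [e]
  refine (eLpNorm_sub_le (hm k) (hm (k + 1)) (by simpa using hp)).trans ?_
  refine (add_le_add (eLpNorm_RL_sub_dyadicApprox_le hα hα1 hp hf hf1 k)
    (eLpNorm_RL_sub_dyadicApprox_le hα hα1 hp hf hf1 (k + 1))).trans ?_
  rw [← ENNReal.ofReal_add (by positivity) (by positivity)]
  refine ENNReal.ofReal_le_ofReal ?_
  have : (2:ℝ) ^ (-α * ((k + 1 : ℕ) : ℝ)) ≤ 2 ^ (-α * k) :=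
    Real.rpow_le_rpow_of_exponent_le (by norm_num) (by push_cast; nlinarith)
  have h2 := mul_le_mul_of_nonneg_left this
    (by positivity : 0 ≤ 2 ^ α / (α * Real.Gamma α))
  linarith

/-- A bound in `L_q` passes to limits in `L_p`. -/
lemma eLpNorm_sub_le_of_tendsto {g : ℕ → ℝ → ℝ} {u v : ℝ → ℝ} {p q B : ℝ≥0∞} (hp : p ≠ 0)
    (hg : ∀ k, AEStronglyMeasurable (g k) unitVol) (hu : AEStronglyMeasurable u unitVol)
    (hv : AEStronglyMeasurable v unitVol)
    (hlim : Tendsto (fun k => eLpNorm (g k - u) p unitVol) atTop (𝓝 0))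
    (hB : ∀ k, eLpNorm (g k - v) q unitVol ≤ B) : eLpNorm (u - v) q unitVol ≤ B := by
  obtain ⟨ns, -, hns⟩ := (tendstoInMeasure_of_tendsto_eLpNorm hp hg hu hlim).exists_seq_tendsto_ae
  refine (Lp.eLpNorm_lim_le_liminf_eLpNorm (f := fun k => g (ns k) - v)
    (fun k => (hg _).sub hv) (u - v) ?_).trans ?_
  · filter_upwards [hns] with t ht
    exact ht.sub_const _
  · exact liminf_le_of_frequently_le' (Frequently.of_forall fun k => hB _)

lemma eLpNorm_RL_sub_dyadicApprox_le_of_lt {α : ℝ} (hα : 0 < α) (hα1 : α ≤ 1) {p : ℝ}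
    (hp : 1 ≤ p) {q : ℝ≥0∞} (hpq : ENNReal.ofReal p ≤ q) (hθ : p⁻¹ - q⁻¹.toReal < α) :
    ∃ C > 0, ∀ f, MemLp f (ENNReal.ofReal p) unitVol → eLpNorm f (ENNReal.ofReal p) unitVol ≤ 1 →
      ∀ K : ℕ, eLpNorm (RL α f - dyadicApprox α f K) q unitVol ≤
        ENNReal.ofReal (C * 2 ^ (-(α - (p⁻¹ - q⁻¹.toReal)) * K)) := by
  have hG := Real.Gamma_pos_of_pos hα
  set θ := p⁻¹ - q⁻¹.toReal with hθd
  set D := 2 * (2 ^ α / (α * Real.Gamma α)) with hD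
  have hD0 : 0 < D := by positivity
  set ρ : ℝ := 2 ^ (-(α - θ)) with hρ
  have hρ0 : 0 < ρ := by positivity
  have hρ1 : ρ < 1 := Real.rpow_lt_one_of_one_lt_of_neg (by norm_num) (by linarith)
  have h1p : 1 ≤ ENNReal.ofReal p := by simpa using hp
  have hq1 : 1 ≤ q := h1p.trans hpq
  refine ⟨D * 2 ^ θ * (1 - ρ)⁻¹, mul_pos (by positivity) (inv_pos.2 (by linarith)), ?_⟩
  intro f hf hf1 K
  have hpow : ∀ k : ℕ, (2:ℝ) ^ (-(α - θ) * k) = ρ ^ k := by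
    intro k
    rw [Real.rpow_mul (by norm_num), Real.rpow_natCast]
  have hm := fun k => (measurable_dyadicApprox α f k).aestronglyMeasurable (μ := unitVol)
  have hstep : ∀ k : ℕ, eLpNorm (dyadicApprox α f (k + 1) - dyadicApprox α f k) q unitVol ≤
      ENNReal.ofReal (D * 2 ^ θ * ρ ^ k) := by
    intro k
    obtain ⟨c, hc⟩ := exists_step_dyadicApprox_sub α f k
    have h1 := eLpNorm_dyadicApprox_sub_le hα hα1 hp hf hf1 k
    simp only [hc] at h1
    have h2 := eLpNorm_step_le (Nat.one_le_two_pow (n := k + 1)) hp (by positivity) hpq h1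
    have e : dyadicApprox α f (k + 1) - dyadicApprox α f k =
      fun t : ℝ => c ⌊((2 ^ (k + 1) : ℕ) : ℝ) * t⌋₊ := funext hc
    rw [e]
    refine h2.trans_eq ?_
    rw [← hθd, two_pow_rpow_neg, ← hpow, ← hD, mul_assoc D, mul_assoc D,
      ← Real.rpow_add (by norm_num), ← Real.rpow_add (by norm_num)]
    congr 3
    push_cast
    ring
  have hsum : ∀ m : ℕ, eLpNorm (dyadicApprox α f (K + m) - dyadicApprox α f K) q unitVol ≤
      ENNReal.ofReal (D * 2 ^ θ * ρ ^ K * ∑ i ∈ Finset.range m, ρ ^ i) := by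
    intro m
    induction m with
    | zero => simp
    | succ m ih =>
      have e : dyadicApprox α f (K + (m + 1)) - dyadicApprox α f K =
          (dyadicApprox α f (K + m + 1) - dyadicApprox α f (K + m)) +
            (dyadicApprox α f (K + m) - dyadicApprox α f K) := by
        rw [← add_assoc]; abel
      rw [e]
      refine (eLpNorm_add_le ((hm _).sub (hm _)) ((hm _).sub (hm _)) hq1).trans ?_
      refine (add_le_add (hstep _) ih).trans ?_
      rw [← ENNReal.ofReal_add (by positivity) (by positivity), Finset.sum_range_succ, pow_add]
      exact ENNReal.ofReal_le_ofReal (le_of_eq (by ring))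
  refine eLpNorm_sub_le_of_tendsto (g := fun m => dyadicApprox α f (K + m))
    (p := ENNReal.ofReal p) (zero_lt_one.trans_le h1p).ne' (fun k => hm _)
    (aestronglyMeasurable_RL α hf.1) (hm K) ?_ fun m => (hsum m).trans ?_
  · have hr1 : (2:ℝ) ^ (-α) < 1 := Real.rpow_lt_one_of_one_lt_of_neg (by norm_num) (by linarith)
    have h0 : Tendsto (fun m : ℕ => ENNReal.ofReal
        (2 ^ α / (α * Real.Gamma α) * ((2:ℝ) ^ (-α)) ^ (m + K))) atTop (𝓝 0) := by
      rw [← ENNReal.ofReal_zero, ← mul_zero (2 ^ α / (α * Real.Gamma α))]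
      refine ENNReal.tendsto_ofReal (Tendsto.const_mul _ ?_)
      exact (tendsto_add_atTop_iff_nat K).2
        (tendsto_pow_atTop_nhds_zero_of_lt_one (by positivity) hr1)
    refine tendsto_of_tendsto_of_tendsto_of_le_of_le tendsto_const_nhds h0 (fun _ => zero_le)
      fun m => ?_
    have := eLpNorm_RL_sub_dyadicApprox_le hα hα1 hp hf hf1 (K + m)
    rw [eLpNorm_sub_comm, add_comm m K, ← Real.rpow_natCast, ← Real.rpow_mul (by norm_num)]
    exact this
  · refine ENNReal.ofReal_le_ofReal ?_
    rw [hpow]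
    have h1 : ∑ i ∈ Finset.range m, ρ ^ i ≤ (1 - ρ)⁻¹ := by
      rw [← tsum_geometric_of_lt_one hρ0.le hρ1]
      exact (summable_geometric_of_lt_one hρ0.le hρ1).sum_le_tsum _ fun _ _ => by positivity
    calc _ ≤ D * 2 ^ θ * ρ ^ K * (1 - ρ)⁻¹ := by gcongr
      _ = _ := by ring

/-- Sums of elements of finite families of functions form a finite family. -/
lemma exists_finset_sums {q : ℝ≥0∞} (S : ℕ → Finset (ℝ → ℝ)) (a : ℕ → ℝ)
    (hc : ∀ k, ((S k).card : ℝ) ≤ 2 ^ a k) (hm : ∀ k, ∀ h ∈ S k, MemLp h q unitVol) (K : ℕ) :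
    ∃ S' : Finset (ℝ → ℝ), (S'.card : ℝ) ≤ 2 ^ ∑ k ∈ Finset.range K, a k ∧
      (∀ h ∈ S', MemLp h q unitVol) ∧ ∀ s : ℕ → ℝ → ℝ, (∀ k, s k ∈ S k) →
        (fun t => ∑ k ∈ Finset.range K, s k t) ∈ S' := by
  classical
  induction K with
  | zero =>
    refine ⟨{fun _ => 0}, by simp, by simp, by simp⟩
  | succ K ih =>
    obtain ⟨S', h1, h2, h3⟩ := ih
    refine ⟨(S' ×ˢ S K).image fun z t => z.1 t + z.2 t, ?_, ?_, fun s hs => ?_⟩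
    · refine (Nat.cast_le.2 Finset.card_image_le).trans ?_
      rw [Finset.card_product, Nat.cast_mul, Finset.sum_range_succ, Real.rpow_add (by norm_num)]
      exact mul_le_mul h1 (hc K) (by positivity) (by positivity)
    · intro h hh
      obtain ⟨z, hz, rfl⟩ := Finset.mem_image.1 hh
      rw [Finset.mem_product] at hz
      exact (h2 _ hz.1).add (hm _ _ hz.2)
    · refine Finset.mem_image.2 ⟨(fun t => ∑ k ∈ Finset.range K, s k t, s K),
        Finset.mem_product.2 ⟨h3 s hs, hs K⟩, ?_⟩
      funext t
      exact (Finset.sum_range_succ (fun k => s k t) K).symm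

lemma summable_rpow_mul_affine {a b c : ℝ} (ha : a < 0) :
    Summable fun n : ℕ => (2:ℝ) ^ (a * n) * (b * n + c) := by
  have h1 : ‖(2:ℝ) ^ a‖ < 1 := by
    rw [Real.norm_of_nonneg (by positivity)]
    exact Real.rpow_lt_one_of_one_lt_of_neg (by norm_num) ha
  have h2 := (summable_pow_mul_geometric_of_norm_lt_one 1 h1).mul_left b
  have h3 := (summable_geometric_of_norm_lt_one h1).mul_left c
  refine (h2.add h3).congr fun n => ?_
  rw [Real.rpow_mul (by norm_num), Real.rpow_natCast]
  ring

/-- Coverings of the level blocks, with summable budgets of bits and errors. -/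
lemma exists_level_covers {α p : ℝ} {q : ℝ≥0∞} (hp : 1 ≤ p) (hpq : ENNReal.ofReal p ≤ q)
    (hα : 0 < α) (hθ0 : 0 ≤ p⁻¹ - q⁻¹.toReal) (hθ : p⁻¹ - q⁻¹.toReal < α) {D : ℝ} (hD : 0 < D) :
    ∃ b e : ℤ → ℝ, (∀ z, 0 ≤ b z) ∧ (∀ z, 0 ≤ e z) ∧ Summable b ∧ Summable e ∧
      ∀ k k₀ : ℕ, ∃ S : Finset (ℝ → ℝ), (S.card : ℝ) ≤ 2 ^ (2 ^ k₀ * b (k - k₀)) ∧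
        (∀ h ∈ S, MemLp h q unitVol) ∧ ∀ c : ℕ → ℝ,
          eLpNorm (fun t : ℝ => c ⌊((2 ^ (k + 1) : ℕ) : ℝ) * t⌋₊) (ENNReal.ofReal p) unitVol ≤
            ENNReal.ofReal (D * 2 ^ (-α * k)) →
          ∃ h ∈ S, eLpNorm (fun t : ℝ => c ⌊((2 ^ (k + 1) : ℕ) : ℝ) * t⌋₊ - h t) q unitVol ≤
            ENNReal.ofReal (2 ^ (-α * k₀) * e (k - k₀)) := by
  set θ := p⁻¹ - q⁻¹.toReal with hθd
  have hp0 : 0 < p := by linarith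
  set β := 2 * α / (α + θ) with hβ
  have hβ1 : 1 < β := by rw [hβ, lt_div_iff₀ (by linarith)]; linarith
  have hβθ : θ * β < α := by
    rw [hβ, ← mul_div_assoc, div_lt_iff₀ (by linarith)]
    nlinarith
  refine ⟨fun z => if 0 ≤ z then 2 * (2 ^ (-(β - 1) * z) * (β * z + 4)) else
      2 * (2 ^ (z:ℝ) * (-(p * (α + 1)) * z + 4)),
    fun z => if 0 ≤ z then D * 2 ^ (-(α - θ * β) * z) else D * 2 ^ (z:ℝ), ?_, ?_, ?_, ?_, ?_⟩
  · intro z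
    dsimp only
    split_ifs with hz
    · have : (0:ℝ) ≤ z := by exact_mod_cast hz
      positivity
    · have : (z:ℝ) ≤ 0 := by exact_mod_cast (not_le.1 hz).le
      have : 0 ≤ -(p * (α + 1)) * z := by
        rw [neg_mul]
        exact neg_nonneg.2 (mul_nonpos_of_nonneg_of_nonpos (by positivity) this)
      positivity
  · intro z
    dsimp only
    split_ifs <;> positivity
  · refine Summable.of_nat_of_neg ?_ ?_
    · refine ((summable_rpow_mul_affine (a := -(β - 1)) (b := β) (c := 4)
        (by linarith)).mul_left 2).congr fun n => ?_
      simp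
    · refine (summable_nat_add_iff 1).1 ?_
      refine ((summable_nat_add_iff 1).2 ((summable_rpow_mul_affine (a := -1)
        (b := p * (α + 1)) (c := 4) (by linarith)).mul_left 2)).congr fun n => ?_
      rw [if_neg (by push_cast; omega)]
      push_cast
      ring_nf
  · refine Summable.of_nat_of_neg ?_ ?_
    · refine ((summable_rpow_mul_affine (a := -(α - θ * β)) (b := 0) (c := 1)
        (by linarith)).mul_left D).congr fun n => ?_
      simp
    · refine (summable_nat_add_iff 1).1 ?_
      refine ((summable_nat_add_iff 1).2 ((summable_rpow_mul_affine (a := -1)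
        (b := 0) (c := 1) (by linarith)).mul_left D)).congr fun n => ?_
      rw [if_neg (by push_cast; omega)]
      push_cast
      ring_nf
  · intro k k₀
    have hN : ((2 ^ (k + 1) : ℕ) : ℝ) = 2 * 2 ^ (k:ℝ) := by
      push_cast
      rw [Real.rpow_natCast]
      ring
    have hk0 : (2:ℝ) ^ k₀ = 2 ^ (k₀:ℝ) := (Real.rpow_natCast _ _).symm
    dsimp only
    split_ifs with hz
    · have hz' : (0:ℝ) ≤ k - k₀ := by exact_mod_cast hz
      obtain ⟨S, h1, h2, h3⟩ := exists_cover_sparse (Nat.one_le_two_pow (n := k + 1)) hp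
        (by positivity : 0 < D * 2 ^ (-α * k)) (s := β * (k - k₀)) (by positivity) hpq
      refine ⟨S, h1.trans_eq ?_, h2, fun c hc => ?_⟩
      · congr 1
        rw [hN, hk0]
        push_cast
        have : (2:ℝ) ^ (k:ℝ) * 2 ^ (-(β * ((k:ℝ) - k₀))) =
            2 ^ (k₀:ℝ) * 2 ^ (-(β - 1) * ((k:ℝ) - k₀)) := by
          rw [← Real.rpow_add (by norm_num), ← Real.rpow_add (by norm_num)]
          congr 1
          ring
        linear_combination 2 * (β * ((k:ℝ) - k₀) + 4) * this
      · obtain ⟨h, hh, he⟩ := h3 c hc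
        refine ⟨h, hh, he.trans_eq ?_⟩
        congr 1
        rw [← hθd]
        push_cast
        have : (2:ℝ) ^ (-α * k) * 2 ^ (θ * (β * ((k:ℝ) - k₀))) =
            2 ^ (-α * (k₀:ℝ)) * 2 ^ (-(α - θ * β) * ((k:ℝ) - k₀)) := by
          rw [← Real.rpow_add (by norm_num), ← Real.rpow_add (by norm_num)]
          congr 1
          ring
        linear_combination D * this
    · have hz' : (k:ℝ) - k₀ ≤ 0 := by exact_mod_cast (not_le.1 hz).le
      obtain ⟨S, h1, h2, h3⟩ := exists_cover_dense (Nat.one_le_two_pow (n := k + 1)) hp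
        (by positivity : 0 < D * 2 ^ (-α * k)) (s := -(p * (α + 1)) * (k - k₀))
        (mul_nonneg_of_nonpos_of_nonpos (by rw [neg_nonpos]; positivity) hz') hpq
      refine ⟨S, h1.trans_eq ?_, h2, fun c hc => ?_⟩
      · congr 1
        rw [hN, hk0]
        push_cast
        have : (2:ℝ) ^ (k:ℝ) = 2 ^ (k₀:ℝ) * 2 ^ ((k:ℝ) - k₀) := by
          rw [← Real.rpow_add (by norm_num)]
          congr 1
          ring
        rw [this]
        ring
      · obtain ⟨h, hh, he⟩ := h3 c hc
        refine ⟨h, hh, he.trans_eq ?_⟩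
        congr 1
        push_cast
        have : (2:ℝ) ^ (-α * k) * 2 ^ (-(-(p * (α + 1)) * ((k:ℝ) - k₀) / p)) =
            2 ^ (-α * (k₀:ℝ)) * 2 ^ ((k:ℝ) - k₀) := by
          rw [← Real.rpow_add (by norm_num), ← Real.rpow_add (by norm_num)]
          congr 1
          field_simp
          ring
        linear_combination D * this

lemma sum_range_sub_le_tsum {b : ℤ → ℝ} (hb : ∀ z, 0 ≤ b z) (hs : Summable b) (K k₀ : ℕ) :
    ∑ k ∈ Finset.range K, b (k - k₀) ≤ ∑' z, b z := by
  have := hs.sum_le_tsum ((Finset.range K).map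
    ⟨fun k : ℕ => (k:ℤ) - k₀, fun i j h => by simpa using h⟩) fun _ _ => hb _
  rw [Finset.sum_map] at this
  exact this

/-- Multiscale covering with budget of order `2^k₀` bits. -/
lemma exists_covers_two_pow {α p : ℝ} {q : ℝ≥0∞} (hp : 1 ≤ p) (hpq : ENNReal.ofReal p ≤ q)
    (hα : 0 < α) (hα1 : α ≤ 1) (hθ0 : 0 ≤ p⁻¹ - q⁻¹.toReal) (hθ : p⁻¹ - q⁻¹.toReal < α) :
    ∃ A > 0, ∃ C > 0, ∀ k₀ : ℕ, ∃ N : ℕ, (N:ℝ) ≤ 2 ^ ((2:ℝ) ^ k₀ * A) ∧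
      Covers α (ENNReal.ofReal p) q N (C * 2 ^ (-α * k₀)) := by
  have hG := Real.Gamma_pos_of_pos hα
  have h1p : 1 ≤ ENNReal.ofReal p := by simpa using hp
  have hq1 : 1 ≤ q := h1p.trans hpq
  set D := 2 * (2 ^ α / (α * Real.Gamma α)) with hD
  have hD0 : 0 < D := by positivity
  obtain ⟨b, e, hb0, he0, hb, he, hcov⟩ := exists_level_covers hp hpq hα hθ0 hθ hD0
  obtain ⟨C, hC, htail⟩ := eLpNorm_RL_sub_dyadicApprox_le_of_lt hα hα1 hp hpq hθ
  refine ⟨∑' z, b z + 1, add_pos_of_nonneg_of_pos (tsum_nonneg hb0) one_pos,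
    ∑' z, e z + 1, add_pos_of_nonneg_of_pos (tsum_nonneg he0) one_pos, fun k₀ => ?_⟩
  choose S hSc hSm hS using fun k => hcov k k₀
  obtain ⟨K, hK⟩ : ∃ K : ℕ, C * 2 ^ (-(α - (p⁻¹ - q⁻¹.toReal)) * K) ≤ 2 ^ (-α * k₀) := by
    have hr1 : (2:ℝ) ^ (-(α - (p⁻¹ - q⁻¹.toReal))) < 1 :=
      Real.rpow_lt_one_of_one_lt_of_neg (by norm_num) (by linarith)
    have h0 := (tendsto_pow_atTop_nhds_zero_of_lt_one (by positivity) hr1).const_mul C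
    rw [mul_zero] at h0
    obtain ⟨K, hK⟩ := (h0.eventually_lt_const
      (by positivity : (0:ℝ) < 2 ^ (-α * k₀))).exists
    refine ⟨K, ?_⟩
    rw [Real.rpow_mul (by norm_num), Real.rpow_natCast]
    exact hK.le
  obtain ⟨S', hc', hm', hS'⟩ := exists_finset_sums S _ hSc hSm K
  refine ⟨S'.card, hc'.trans ?_, S', le_rfl, hm', fun f hf hf1 => ?_⟩
  · refine Real.rpow_le_rpow_of_exponent_le (by norm_num) ?_
    rw [← Finset.mul_sum]
    have := sum_range_sub_le_tsum hb0 hb K k₀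
    gcongr
    linarith
  have hlev : ∀ k, ∃ h ∈ S k, eLpNorm
      (fun t => dyadicApprox α f (k + 1) t - dyadicApprox α f k t - h t) q unitVol ≤
        ENNReal.ofReal (2 ^ (-α * k₀) * e (k - k₀)) := by
    intro k
    obtain ⟨c, hc⟩ := exists_step_dyadicApprox_sub α f k
    have h1 := eLpNorm_dyadicApprox_sub_le hα hα1 hp hf hf1 k
    simp only [hc] at h1 ⊢
    exact hS k c h1
  choose s hs hse using hlev
  refine ⟨_, hS' s hs, ?_⟩
  have hms : ∀ k, AEStronglyMeasurable (s k) unitVol := fun k => (hSm k _ (hs k)).1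
  have hmd := fun k => (measurable_dyadicApprox α f k).aestronglyMeasurable (μ := unitVol)
  have hmR := aestronglyMeasurable_RL α hf.1
  have hae : (fun t => RL α f t - ∑ k ∈ Finset.range K, s k t) =ᵐ[unitVol]
      (RL α f - dyadicApprox α f K) + ∑ k ∈ Finset.range K,
        fun t => dyadicApprox α f (k + 1) t - dyadicApprox α f k t - s k t := by
    have h1 : ∀ᵐ t ∂unitVol, t ∈ Ico (0:ℝ) 1 := by
      rw [unitVol, ← restrict_Ico_eq_restrict_Icc]
      exact ae_restrict_mem measurableSet_Ico
    filter_upwards [h1] with t ht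
    simp only [Pi.add_apply, Pi.sub_apply, Finset.sum_apply, Finset.sum_sub_distrib]
    rw [← Finset.sum_sub_distrib, Finset.sum_range_sub (fun k => dyadicApprox α f k t),
      dyadicApprox_zero α f ht]
    ring
  rw [eLpNorm_congr_ae hae]
  refine (eLpNorm_add_le (hmR.sub (hmd K)) (Finset.aestronglyMeasurable_sum _
    fun k _ => ((hmd _).sub (hmd _)).sub (hms k)) hq1).trans ?_
  refine (add_le_add ((htail f hf hf1 K).trans (ENNReal.ofReal_le_ofReal hK))
    ((eLpNorm_sum_le (fun k _ => ((hmd _).sub (hmd _)).sub (hms k)) hq1).trans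
      (Finset.sum_le_sum fun k _ => hse k))).trans ?_
  rw [← ENNReal.ofReal_sum_of_nonneg (fun k _ => mul_nonneg (by positivity) (he0 _)),
    ← ENNReal.ofReal_add (by positivity)
      (Finset.sum_nonneg fun k _ => mul_nonneg (by positivity) (he0 _)), ← Finset.mul_sum]
  refine ENNReal.ofReal_le_ofReal ?_
  have := mul_le_mul_of_nonneg_left (sum_range_sub_le_tsum he0 he K k₀)
    (by positivity : (0:ℝ) ≤ 2 ^ (-α * k₀))
  linarith

lemma UpperBound.of_two_pow {α A C : ℝ} {p q : ℝ≥0∞} (hq : 1 ≤ q) (hα : 0 < α) (hA : 0 < A)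
    (hC : 0 < C) (h : ∀ k₀ : ℕ, ∃ N : ℕ, (N:ℝ) ≤ 2 ^ ((2:ℝ) ^ k₀ * A) ∧
      Covers α p q N (C * 2 ^ (-α * k₀))) : UpperBound α p q := by
  obtain ⟨N₁, -, h₁⟩ := h 0
  obtain ⟨C₁, hC₁, h₁⟩ := h₁.one hq
  refine ⟨max (C₁ * (A + 1) ^ α) (C * (2 * (A + 1)) ^ α), by positivity, fun n hn => ?_⟩
  have hn1 : (1:ℝ) ≤ n := by exact_mod_cast hn
  rcases lt_or_ge ((n:ℝ) - 1) A with hnA | hnA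
  · refine h₁.mono le_rfl le_rfl Nat.one_le_two_pow ?_
    calc C₁ = C₁ * (A + 1) ^ α * (A + 1) ^ (-α) := by
          rw [mul_assoc, ← Real.rpow_add (by linarith)]; simp
      _ ≤ _ := by
          refine mul_le_mul (le_max_left _ _) ?_ (by positivity) (by positivity)
          exact Real.rpow_le_rpow_of_nonpos (by linarith) (by linarith) (by linarith)
  · obtain ⟨k₀, hk1, hk2⟩ := exists_nat_pow_near ((one_le_div hA).2 hnA) one_lt_two
    obtain ⟨N, hN, hc⟩ := h k₀
    refine hc.mono le_rfl le_rfl ?_ ?_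
    · rw [le_div_iff₀ hA] at hk1
      have : (N:ℝ) ≤ ((2 ^ (n - 1) : ℕ) : ℝ) := by
        refine (hN.trans (Real.rpow_le_rpow_of_exponent_le (by norm_num) hk1)).trans_eq ?_
        rw [Nat.cast_pow, ← Real.rpow_natCast, Nat.cast_sub hn]
        simp
      exact_mod_cast this
    · have h3 : (n:ℝ) / (2 * (A + 1)) ≤ 2 ^ (k₀:ℝ) := by
        rw [div_lt_iff₀ hA, pow_succ] at hk2
        rw [Real.rpow_natCast, div_le_iff₀ (by positivity)]
        have : (1:ℝ) ≤ 2 ^ k₀ := one_le_pow₀ (by norm_num)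
        nlinarith
      have hn0 : (0:ℝ) < n := by linarith
      calc C * 2 ^ (-α * k₀) = C * (2 ^ (k₀:ℝ)) ^ (-α) := by
            rw [← Real.rpow_mul (by norm_num), mul_comm (-α)]
        _ ≤ C * (n / (2 * (A + 1))) ^ (-α) := by
            gcongr C * ?_
            exact Real.rpow_le_rpow_of_nonpos (by positivity) h3 (by linarith)
        _ = C * (2 * (A + 1)) ^ α * n ^ (-α) := by
            rw [Real.div_rpow hn0.le (by positivity),
              Real.rpow_neg (by positivity : 0 ≤ 2 * (A + 1))]
            field_simp
        _ ≤ _ := by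
            gcongr
            exact le_max_right _ _

lemma toReal_inv_le_of_ofReal_le {p : ℝ} (hp : 1 ≤ p) {q : ℝ≥0∞} (hpq : ENNReal.ofReal p ≤ q) :
    q⁻¹.toReal ≤ p⁻¹ := by
  have h := ENNReal.inv_le_inv.2 hpq
  rw [← ENNReal.ofReal_inv_of_pos (by linarith)] at h
  exact ENNReal.toReal_le_of_le_ofReal (by positivity) h

lemma le_ofReal_of_inv_le {r : ℝ} (hr : 0 < r) {q : ℝ≥0∞} (hq : q ≠ 0)
    (h : q⁻¹.toReal ≤ r⁻¹) : ENNReal.ofReal r ≤ q := by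
  rw [← ENNReal.inv_le_inv, ← ENNReal.ofReal_inv_of_pos hr]
  exact (ENNReal.le_ofReal_iff_toReal_le (ENNReal.inv_ne_top.2 hq) (by positivity)).2 h

lemma upperBound_of_lt_two_pow (j : ℕ) : ∀ {α p : ℝ} {q : ℝ≥0∞}, 1 ≤ p → ENNReal.ofReal p ≤ q →
    0 < α → α ≤ 2 ^ j → p⁻¹ - q⁻¹.toReal < α → UpperBound α (ENNReal.ofReal p) q := by
  induction j with
  | zero =>
    intro α p q hp hpq hα hα1 hθ
    obtain ⟨A, hA, C, hC, h⟩ := exists_covers_two_pow hp hpq hα (by simpa using hα1)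
      (sub_nonneg.2 (toReal_inv_le_of_ofReal_le hp hpq)) hθ
    exact UpperBound.of_two_pow ((by simpa using hp : 1 ≤ ENNReal.ofReal p).trans hpq) hα hA hC h
  | succ j ih =>
    intro α p q hp hpq hα hα1 hθ
    have hpq' := toReal_inv_le_of_ofReal_le hp hpq
    have hp0 : 0 < p⁻¹ := by positivity
    have h1p : 1 ≤ ENNReal.ofReal p := by simpa using hp
    have hq0 : q ≠ 0 := (zero_lt_one.trans_le (h1p.trans hpq)).ne'
    have hqt : 0 ≤ q⁻¹.toReal := ENNReal.toReal_nonneg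
    set r : ℝ := 2 / (p⁻¹ + q⁻¹.toReal) with hr
    have hr0 : 0 < r := by positivity
    have hrinv : r⁻¹ = (p⁻¹ + q⁻¹.toReal) / 2 := by rw [hr, inv_div]
    have hpr : p ≤ r := by
      rw [← inv_le_inv₀ hr0 (by linarith), hrinv]
      linarith
    have hα2 : α / 2 ≤ 2 ^ j := by
      rw [pow_succ] at hα1
      linarith
    have hrr : (ENNReal.ofReal r)⁻¹.toReal = r⁻¹ := by
      rw [← ENNReal.ofReal_inv_of_pos hr0, ENNReal.toReal_ofReal (by positivity)]
    have h1 : UpperBound (α / 2) (ENNReal.ofReal p) (ENNReal.ofReal r) :=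
      ih hp (ENNReal.ofReal_le_ofReal hpr) (by linarith) hα2 (by rw [hrr, hrinv]; linarith)
    have h2 : UpperBound (α / 2) (ENNReal.ofReal r) q :=
      ih (hp.trans hpr) (le_ofReal_of_inv_le hr0 hq0 (by rw [hrinv]; linarith)) (by linarith) hα2
        (by rw [hrinv]; linarith)
    have := h1.comp (by linarith) (by linarith) h1p (by simpa using hp.trans hpr) h2
    rwa [add_halves] at this

/-- The upper estimate for all admissible parameters. -/
lemma upperBound {α : ℝ} {p q : ℝ≥0∞} (hp : 1 ≤ p) (hα : 0 < α)
    (hθ : p⁻¹.toReal - q⁻¹.toReal < α) : UpperBound α p q := by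
  have key : ∀ {p' : ℝ} {q' : ℝ≥0∞}, 1 ≤ p' → ENNReal.ofReal p' ≤ q' →
      p'⁻¹ - q'⁻¹.toReal < α → UpperBound α (ENNReal.ofReal p') q' := by
    intro p' q' h1 h2 h3
    obtain ⟨j, hj⟩ := pow_unbounded_of_one_lt α one_lt_two
    exact upperBound_of_lt_two_pow j h1 h2 hα hj.le h3
  rcases eq_or_ne p ⊤ with rfl | hpt
  · have h1 : 1 ≤ max 1 (2 / α) := le_max_left _ _
    refine (key (p' := max 1 (2 / α)) (q' := ⊤) h1 le_top ?_).mono le_top le_top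
    simp only [ENNReal.inv_top, ENNReal.toReal_zero, sub_zero]
    rw [inv_lt_comm₀ (by positivity) hα]
    refine lt_of_lt_of_le ?_ (le_max_right _ _)
    rw [← one_div]
    gcongr
    norm_num
  · have hpr : ENNReal.ofReal p.toReal = p := ENNReal.ofReal_toReal hpt
    have h1 : 1 ≤ p.toReal := by
      rw [← ENNReal.toReal_one]
      exact ENNReal.toReal_mono hpt hp
    have := key (p' := p.toReal) (q' := max p q) h1 (by rw [hpr]; exact le_max_left _ _) ?_
    · rw [hpr] at this
      exact this.mono le_rfl (le_max_right _ _)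
    · rcases le_total p q with h | h
      · rwa [max_eq_right h, ← ENNReal.toReal_inv]
      · rw [max_eq_left h, ← ENNReal.toReal_inv, sub_self]
        exact hα

/-- A family of `2^(8 * n)` sets mapped to at most `4^n` values has two members with equal values
that differ in more than `n` elements. -/
lemma exists_card_symmDiff_gt {ι : Type*} {n : ℕ} (hn : 1 ≤ n) {F : Finset ℕ → ι} {S : Finset ι}
    (hS : S.card ≤ 2 ^ (2 * n)) (hF : ∀ η, F η ∈ S) :
    ∃ η ⊆ Finset.range (8 * n), ∃ η' ⊆ Finset.range (8 * n),
      F η = F η' ∧ n < (symmDiff η η').card := by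
  classical
  by_contra! hcon
  set P := (Finset.range (8 * n)).powerset with hP
  set Q := P.filter fun ζ => ζ.card ≤ n with hQ
  have hQc : (Q.card : ℝ) ≤ 2 ^ n * (3 / 2) ^ (8 * n) := by
    have h1 := Finset.sum_pow_mul_eq_add_pow (1 / 2 : ℝ) 1 (Finset.range (8 * n))
    simp only [one_pow, mul_one, Finset.card_range] at h1
    have h2 : (Q.card : ℝ) * (1 / 2) ^ n ≤ (1 / 2 + 1) ^ (8 * n) := by
      rw [← h1, ← nsmul_eq_mul, ← Finset.sum_const]
      refine le_trans (Finset.sum_le_sum fun ζ hζ => ?_)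
        (Finset.sum_le_sum_of_subset_of_nonneg (Finset.filter_subset _ _)
          fun _ _ _ => by positivity)
      exact pow_le_pow_of_le_one (by norm_num) (by norm_num) (Finset.mem_filter.1 hζ).2
    rw [one_div, inv_pow, ← div_eq_mul_inv, div_le_iff₀ (by positivity)] at h2
    refine h2.trans_eq ?_
    norm_num [mul_comm]
  have hfib : ∀ b ∈ S, (P.filter fun η => F η = b).card ≤ Q.card := by
    intro b _
    rcases (P.filter fun η => F η = b).eq_empty_or_nonempty with he | ⟨η₀, h₀⟩
    · rw [he]
      simp
    rw [Finset.mem_filter, Finset.mem_powerset] at h₀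
    refine Finset.card_le_card_of_injOn (fun η => symmDiff η η₀) ?_
      fun η _ η' _ h => symmDiff_left_injective η₀ h
    intro η hη
    rw [Finset.mem_coe, Finset.mem_filter, Finset.mem_powerset] at hη
    rw [Finset.mem_coe, Finset.mem_filter, Finset.mem_powerset]
    refine ⟨fun x hx => ?_, hcon η hη.1 η₀ h₀.1 (hη.2.trans h₀.2.symm)⟩
    rcases Finset.mem_symmDiff.1 hx with h | h
    · exact hη.1 h.1
    · exact h₀.1 h.1
  have h3 := Finset.card_le_mul_card_image_of_maps_to (s := P) (fun η _ => hF η) Q.card hfib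
  rw [Finset.card_powerset, Finset.card_range] at h3
  have h4 : ((2 ^ (8 * n) : ℕ) : ℝ) ≤ 2 ^ n * (3 / 2) ^ (8 * n) * 2 ^ (2 * n) := by
    refine (Nat.cast_le.2 h3).trans ?_
    rw [Nat.cast_mul]
    refine mul_le_mul hQc ?_ (by positivity) (by positivity)
    exact_mod_cast hS
  have h5 : (2:ℝ) ^ n * (3 / 2) ^ (8 * n) * 2 ^ (2 * n) < 2 ^ (8 * n) := by
    rw [pow_mul, pow_mul, pow_mul, ← mul_pow, ← mul_pow]
    exact pow_lt_pow_left₀ (by norm_num) (by norm_num) (by omega)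
  push_cast at h4
  linarith

lemma RL_one_deriv {g : ℝ → ℝ} (hg : ContDiff ℝ 1 g) (h0 : g 0 = 0) {t : ℝ}
    (ht : t ∈ Icc (0:ℝ) 1) : RL 1 (deriv g) t = g t := by
  rw [RL_eq_intervalIntegral 1 (deriv g) ht]
  simp only [sub_self, Real.rpow_zero, one_mul, Real.Gamma_one, div_one]
  rw [intervalIntegral.integral_deriv_eq_sub
    (fun x _ => (hg.differentiable (by norm_num)).differentiableAt)
    ((hg.continuous_deriv le_rfl).intervalIntegrable _ _), h0, sub_zero]

lemma _root_.Continuous.integrable_unitVol {f : ℝ → ℝ} (hf : Continuous f) :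
    Integrable f unitVol :=
  hf.continuousOn.integrableOn_compact isCompact_Icc

/-- `RL k` inverts the `k`-th derivative of smooth functions vanishing near `0`. -/
lemma RL_iteratedDeriv {δ : ℝ} (hδ : 0 < δ) (k : ℕ) : ∀ {g : ℝ → ℝ}, ContDiff ℝ (⊤ : ℕ∞) g →
    (∀ t < δ, g t = 0) → ∀ᵐ t ∂unitVol, RL ((k + 1 : ℕ) : ℝ) (iteratedDeriv (k + 1) g) t = g t := by
  induction k with
  | zero =>
    intro g hg h0
    filter_upwards [ae_restrict_mem measurableSet_Icc] with t ht
    rw [zero_add, iteratedDeriv_one, Nat.cast_one]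
    exact RL_one_deriv (hg.of_le (by exact_mod_cast le_top)) (h0 0 hδ) ht
  | succ k ih =>
    intro g hg h0
    have hdg : ContDiff ℝ (⊤ : ℕ∞) (deriv g) := by
      simpa using hg.iterate_deriv 1
    have hdg0 : ∀ t < δ, deriv g t = 0 := by
      intro t ht
      have : g =ᶠ[𝓝 t] fun _ => 0 := by
        filter_upwards [Iio_mem_nhds ht] with s hs using h0 s hs
      rw [this.deriv_eq, deriv_const]
    have h1 := ih hdg hdg0
    have hgi : Integrable (iteratedDeriv (k + 1 + 1) g) unitVol :=
      (hg.continuous_iteratedDeriv _ (by exact_mod_cast le_top)).integrable_unitVol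
    have h2 := RL_RL (α := ((k + 1 : ℕ) : ℝ)) (β := 1) (by positivity) one_pos hgi
    filter_upwards [h2, ae_restrict_mem measurableSet_Icc] with t ht2 ht
    rw [Nat.cast_succ (k + 1), ← ht2, iteratedDeriv_succ', RL_congr 1 h1 t]
    exact RL_one_deriv (hg.of_le (by exact_mod_cast le_top)) (h0 0 hδ) ht

/-- A smooth bump supported in `[1/4, 3/4]`. -/
noncomputable def profile : ContDiffBump (1 / 2 : ℝ) :=
  ⟨1 / 8, 1 / 4, by norm_num, by norm_num⟩

lemma profile_eq_zero {x : ℝ} (hx : x ∉ Icc (1 / 4 : ℝ) (3 / 4)) : profile x = 0 := by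
  refine profile.zero_of_le_dist ?_
  change (1 / 4 : ℝ) ≤ dist x (1 / 2)
  rw [Real.dist_eq]
  by_contra! h
  rw [abs_lt] at h
  exact hx ⟨by linarith, by linarith⟩

lemma profile_eq_one {x : ℝ} (hx : x ∈ Icc (3 / 8 : ℝ) (5 / 8)) : profile x = 1 := by
  refine profile.one_of_mem_closedBall ?_
  change dist x (1 / 2) ≤ (1 / 8 : ℝ)
  rw [Real.dist_eq, abs_le]
  constructor <;> linarith [hx.1, hx.2]

lemma iteratedDeriv_profile_eq_zero (k : ℕ) {x : ℝ} (hx : x ∉ Icc (1 / 4 : ℝ) (3 / 4)) :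
    iteratedDeriv k profile x = 0 := by
  have : (profile : ℝ → ℝ) =ᶠ[𝓝 x] fun _ => 0 := by
    filter_upwards [isClosed_Icc.isOpen_compl.mem_nhds hx] with y hy using profile_eq_zero hy
  rw [this.iteratedDeriv_eq]
  simp

lemma exists_iteratedDeriv_profile_bound (k : ℕ) :
    ∃ B > 0, ∀ x, |iteratedDeriv k profile x| ≤ B := by
  have hc : Continuous (iteratedDeriv k profile) :=
    (profile.contDiff (n := ⊤)).continuous_iteratedDeriv k (by exact_mod_cast le_top)
  obtain ⟨B, hB⟩ := (isCompact_Icc (a := (1 / 4 : ℝ)) (b := 3 / 4)).exists_bound_of_continuousOn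
    hc.continuousOn
  refine ⟨max B 1, by positivity, fun x => ?_⟩
  by_cases hx : x ∈ Icc (1 / 4 : ℝ) (3 / 4)
  · exact (hB x hx).trans (le_max_left _ _)
  · rw [iteratedDeriv_profile_eq_zero k hx, abs_zero]
    positivity

/-- The sum of the bumps over the cells of length `1/m` indexed by `η`. -/
noncomputable def bumpSum (m : ℕ) (η : Finset ℕ) (t : ℝ) : ℝ :=
  ∑ j ∈ η, profile (m * t - j)

lemma sum_cells_eq {D : ℝ → ℝ} (hD : ∀ x ∉ Icc (1 / 4 : ℝ) (3 / 4), D x = 0) (η : Finset ℕ)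
    (y : ℝ) : ∑ j ∈ η, D (y - j) = if ⌊y⌋₊ ∈ η then D (y - ⌊y⌋₊) else 0 := by
  rw [← Finset.sum_ite_eq' η ⌊y⌋₊ fun j => D (y - j)]
  refine Finset.sum_congr rfl fun j _ => ?_
  split_ifs with h
  · rfl
  · refine hD _ fun hy => h ?_
    have h0 : (0:ℝ) ≤ j := j.cast_nonneg
    exact ((Nat.floor_eq_iff (by linarith [hy.1])).2
      ⟨by linarith [hy.1], by linarith [hy.2]⟩).symm

lemma contDiff_bumpSum (m : ℕ) (η : Finset ℕ) : ContDiff ℝ (⊤ : ℕ∞) (bumpSum m η) := by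
  refine ContDiff.sum fun j _ => ?_
  exact (profile.contDiff (n := ⊤)).comp ((contDiff_const.mul contDiff_id).sub contDiff_const)

lemma bumpSum_eq_zero {m : ℕ} (hm : 1 ≤ m) (η : Finset ℕ) {t : ℝ} (ht : t < 1 / (4 * m)) :
    bumpSum m η t = 0 := by
  have hm0 : (0:ℝ) < m := by exact_mod_cast hm
  refine Finset.sum_eq_zero fun j _ => profile_eq_zero fun h => ?_
  rw [lt_div_iff₀ (by positivity)] at ht
  have h0 : (0:ℝ) ≤ j := j.cast_nonneg
  linarith [h.1]

lemma iteratedDeriv_bumpSum (k m : ℕ) (η : Finset ℕ) (t : ℝ) :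
    iteratedDeriv k (bumpSum m η) t = m ^ k * ∑ j ∈ η, iteratedDeriv k profile (m * t - j) := by
  have hs : ∀ j : ℕ, ContDiff ℝ k fun x : ℝ => profile (x - j) := fun j =>
    (profile.contDiff (n := k)).comp (contDiff_id.sub contDiff_const)
  have hc : ∀ j : ℕ, ContDiff ℝ k fun x : ℝ => profile (m * x - j) := fun j =>
    (profile.contDiff (n := k)).comp ((contDiff_const.mul contDiff_id).sub contDiff_const)
  unfold bumpSum
  rw [iteratedDeriv_fun_sum fun j _ => (hc j).contDiffAt, Finset.mul_sum]
  refine Finset.sum_congr rfl fun j _ => ?_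
  rw [iteratedDeriv_comp_const_mul (hs j) (m:ℝ), iteratedDeriv_comp_sub_const]

lemma abs_iteratedDeriv_bumpSum_le {k : ℕ} {B : ℝ} (hB : 0 < B)
    (h : ∀ x, |iteratedDeriv k profile x| ≤ B) (m : ℕ) (η : Finset ℕ) (t : ℝ) :
    |iteratedDeriv k (bumpSum m η) t| ≤ m ^ k * B := by
  rw [iteratedDeriv_bumpSum, sum_cells_eq (fun x hx => iteratedDeriv_profile_eq_zero k hx),
    abs_mul, abs_of_nonneg (by positivity : (0:ℝ) ≤ m ^ k)]
  gcongr
  split_ifs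
  · exact h _
  · simpa using hB.le

lemma le_eLpNorm_bumpSum_sub {m : ℕ} (hm : 1 ≤ m) {η η' : Finset ℕ} (hη : η ⊆ Finset.range m)
    (hη' : η' ⊆ Finset.range m) : ENNReal.ofReal ((symmDiff η η').card / (4 * m)) ≤
      eLpNorm (fun t => bumpSum m η t - bumpSum m η' t) 1 unitVol := by
  have hm0 : (0:ℝ) < m := by exact_mod_cast hm
  rw [eLpNorm_one_eq_lintegral_enorm]
  refine le_trans ?_ (sum_lintegral_cells_le hm _)
  have hsub : symmDiff η η' ⊆ Finset.range m := by
    intro x hx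
    rcases Finset.mem_symmDiff.1 hx with h | h
    · exact hη h.1
    · exact hη' h.1
  refine le_trans ?_ (Finset.sum_le_sum_of_subset hsub)
  have hcell : ∀ j ∈ symmDiff η η', ENNReal.ofReal (1 / (4 * m)) ≤
      ∫⁻ t in Ico ((j:ℝ) / m) ((j + 1) / m), ‖bumpSum m η t - bumpSum m η' t‖ₑ := by
    intro j hj
    have hss : Icc (((j:ℝ) + 3 / 8) / m) ((j + 5 / 8) / m) ⊆ Ico ((j:ℝ) / m) ((j + 1) / m) := by
      intro t ht
      refine ⟨le_trans ?_ ht.1, lt_of_le_of_lt ht.2 ?_⟩ <;> gcongr <;> linarith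
    refine le_trans ?_ (lintegral_mono_set hss)
    rw [setLIntegral_congr_fun (g := fun _ => 1) measurableSet_Icc, setLIntegral_const, one_mul,
      Real.volume_Icc]
    · refine ENNReal.ofReal_le_ofReal (le_of_eq ?_)
      field_simp
      ring
    · intro t ht
      have hfl := floor_mul_eq hm (hss ht)
      have h1 := (div_le_iff₀ hm0).1 ht.1
      have h2 := (le_div_iff₀ hm0).1 ht.2
      have hp : profile (m * t - j) = 1 := profile_eq_one ⟨by linarith, by linarith⟩
      have hz : ∀ x ∉ Icc (1 / 4 : ℝ) (3 / 4), profile x = 0 := fun x hx => profile_eq_zero hx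
      simp only [bumpSum, sum_cells_eq hz, hfl, hp]
      rcases Finset.mem_symmDiff.1 hj with h | h
      · simp [h.1, h.2]
      · simp [h.1, h.2]
  refine le_trans (le_of_eq ?_) (Finset.sum_le_sum hcell)
  rw [Finset.sum_const, nsmul_eq_mul, ← ENNReal.ofReal_natCast, ← ENNReal.ofReal_mul (by positivity)]
  congr 1
  ring

/-- The lower estimate for integers. -/
lemma lower_bound_nat (k : ℕ) (p : ℝ≥0∞) : ∃ c > 0, ∀ n : ℕ, 1 ≤ n → ∀ ε > 0,
    Covers ((k + 1 : ℕ) : ℝ) p 1 (2 ^ (2 * n)) ε → c * (n:ℝ) ^ (-((k + 1 : ℕ) : ℝ)) ≤ ε := by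
  obtain ⟨B, hB0, hB⟩ := exists_iteratedDeriv_profile_bound (k + 1)
  refine ⟨1 / (64 * (8 ^ (k + 1) * B)), by positivity, fun n hn ε hε ⟨S, hSc, hSm, hS⟩ => ?_⟩
  have hn0 : (0:ℝ) < n := by exact_mod_cast hn
  have hm : 1 ≤ 8 * n := by omega
  set M : ℝ := ((8 * n : ℕ) : ℝ) ^ (k + 1) * B with hM
  have hM0 : 0 < M := by positivity
  have hcont : ∀ η, Continuous (iteratedDeriv (k + 1) (bumpSum (8 * n) η)) := fun η =>
    (contDiff_bumpSum _ η).continuous_iteratedDeriv _ (by exact_mod_cast le_top)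
  have hmem : ∀ η, ∃ h ∈ S, eLpNorm (fun t => bumpSum (8 * n) η t - M * h t) 1 unitVol ≤
      ENNReal.ofReal (M * ε) := by
    intro η
    have hbd : ∀ᵐ t ∂unitVol, ‖M⁻¹ * iteratedDeriv (k + 1) (bumpSum (8 * n) η) t‖ ≤ 1 := by
      refine ae_of_all _ fun t => ?_
      rw [norm_mul, Real.norm_of_nonneg (by positivity), inv_mul_le_iff₀ hM0, mul_one]
      exact abs_iteratedDeriv_bumpSum_le hB0 hB _ _ _
    have hms := ((hcont η).const_mul M⁻¹).aestronglyMeasurable (μ := unitVol)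
    obtain ⟨h, hh, he⟩ := hS _ (MemLp.of_bound hms 1 hbd)
      ((eLpNorm_le_of_ae_bound hbd).trans (by simp))
    refine ⟨h, hh, ?_⟩
    have hae : (fun t => bumpSum (8 * n) η t - M * h t) =ᵐ[unitVol] fun t => M * (RL
        ((k + 1 : ℕ) : ℝ) (fun t => M⁻¹ * iteratedDeriv (k + 1) (bumpSum (8 * n) η) t) t - h t) := by
      filter_upwards [RL_iteratedDeriv (δ := 1 / (4 * ((8 * n : ℕ) : ℝ)))
        (by positivity) k (contDiff_bumpSum (8 * n) η)
        (fun t ht => bumpSum_eq_zero hm η ht)] with t ht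
      rw [RL_const_mul, ht]
      field_simp
    rw [eLpNorm_congr_ae hae, eLpNorm_const_mul_fun, abs_of_pos hM0, ENNReal.ofReal_mul hM0.le]
    exact mul_le_mul' le_rfl he
  choose F hFS hF using hmem
  obtain ⟨η, hη, η', hη', hFe, hcard⟩ := exists_card_symmDiff_gt hn hSc hFS
  have hmF : AEStronglyMeasurable (fun t => M * F η t) unitVol :=
    ((hSm _ (hFS η)).const_mul M).1
  have hmb := fun η => (contDiff_bumpSum (8 * n) η).continuous.aestronglyMeasurable (μ := unitVol)
  have h1 := le_eLpNorm_bumpSum_sub hm hη hη'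
  have e : (fun t => bumpSum (8 * n) η t - bumpSum (8 * n) η' t) =
      (fun t => bumpSum (8 * n) η t - M * F η t) - fun t => bumpSum (8 * n) η' t - M * F η' t := by
    ext t
    simp [hFe]
  rw [e] at h1
  have h2 := h1.trans ((eLpNorm_sub_le ((hmb η).sub hmF) ((hmb η').sub (hFe ▸ hmF)) le_rfl).trans
    (add_le_add (hF η) (hF η')))
  rw [← ENNReal.ofReal_add (by positivity) (by positivity),
    ENNReal.ofReal_le_ofReal_iff (by positivity), div_le_iff₀ (by positivity)] at h2
  have h3 : (n:ℝ) ≤ (symmDiff η η').card := by exact_mod_cast hcard.le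
  have h4 : (1:ℝ) ≤ 64 * M * ε := by
    have : (n:ℝ) * 1 ≤ n * (64 * M * ε) := by
      push_cast at h2
      linarith
    exact le_of_mul_le_mul_left this hn0
  rw [Real.rpow_neg hn0.le, Real.rpow_natCast, ← div_eq_mul_inv, div_le_iff₀ (by positivity),
    div_le_iff₀ (by positivity)]
  refine h4.trans_eq ?_
  rw [hM]
  push_cast
  rw [mul_pow]
  ring

/-- The lower estimate for all admissible parameters. -/
lemma lower_bound {α : ℝ} {p q : ℝ≥0∞} (hp : 1 ≤ p) (hq : 1 ≤ q) (hα : 0 < α) :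
    ∃ c > 0, ∀ n : ℕ, 1 ≤ n → ∀ ε > 0, Covers α p q (2 ^ (n - 1)) ε → c * (n:ℝ) ^ (-α) ≤ ε := by
  obtain ⟨k, hk⟩ := exists_nat_gt α
  have hβ : 0 < ((k + 1 : ℕ) : ℝ) - α := by
    push_cast
    linarith
  obtain ⟨C, hC, hU⟩ := upperBound (p := 1) (q := 1) le_rfl hβ (by simpa using hβ)
  obtain ⟨c, hc, hL⟩ := lower_bound_nat k p
  refine ⟨c / C, by positivity, fun n hn ε hε h => ?_⟩
  have hn0 : (0:ℝ) < n := by exact_mod_cast hn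
  have h1 := (h.mono le_rfl hq le_rfl le_rfl).comp hα hβ hp le_rfl hε (hU n hn)
  rw [add_sub_cancel] at h1
  have h2 := hL n hn _ (by positivity) (h1.mono le_rfl le_rfl
    (by rw [← pow_add]; exact Nat.pow_le_pow_right (by norm_num) (by omega)) le_rfl)
  have e : (n:ℝ) ^ (-((k + 1 : ℕ) : ℝ)) = n ^ (-α) * n ^ (-(((k + 1 : ℕ) : ℝ) - α)) := by
    rw [← Real.rpow_add hn0]
    congr 1
    ring
  rw [e, ← mul_assoc, ← mul_assoc] at h2
  have h3 := le_of_mul_le_mul_right h2 (by positivity)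
  rw [div_mul_eq_mul_div, div_le_iff₀ hC]
  exact h3

section Lp

variable {α : ℝ} {p q : ℝ≥0∞} [Fact (1 ≤ p)] [Fact (1 ≤ q)]
  {T : Lp ℝ p unitVol →L[ℝ] Lp ℝ q unitVol}

lemma Covers.of_subset_closedBall (hT : ∀ f : Lp ℝ p unitVol, T f =ᵐ[unitVol] RL α f)
    {S : Finset (Lp ℝ q unitVol)} {ε : ℝ} (hε : 0 ≤ ε)
    (hS : T '' Metric.closedBall 0 1 ⊆ ⋃ x ∈ S, Metric.closedBall x ε) :
    Covers α p q S.card ε := by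
  classical
  refine ⟨S.image fun x : Lp ℝ q unitVol => (x : ℝ → ℝ), Finset.card_image_le, ?_, fun f hf hf1 => ?_⟩
  · intro h hh
    obtain ⟨x, -, rfl⟩ := Finset.mem_image.1 hh
    exact Lp.memLp x
  have hb : hf.toLp f ∈ Metric.closedBall (0 : Lp ℝ p unitVol) 1 := by
    rw [mem_closedBall_zero_iff, Lp.norm_toLp]
    exact ENNReal.toReal_le_of_le_ofReal zero_le_one (by simpa using hf1)
  obtain ⟨x, hx, hd⟩ := mem_iUnion₂.1 (hS (mem_image_of_mem T hb))
  refine ⟨x, Finset.mem_image_of_mem _ hx, ?_⟩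
  rw [Metric.mem_closedBall, dist_eq_norm, Lp.norm_def] at hd
  rw [ENNReal.le_ofReal_iff_toReal_le _ hε]
  · refine le_trans (le_of_eq ?_) hd
    congr 1
    refine eLpNorm_congr_ae ?_
    filter_upwards [Lp.coeFn_sub (T (hf.toLp f)) x, hT (hf.toLp f)] with t h1 h2
    rw [h1, Pi.sub_apply, h2, RL_congr α hf.coeFn_toLp t]
  · have h : (fun t => RL α f t - x t) =ᵐ[unitVol] (T (hf.toLp f) - x : Lp ℝ q unitVol) := by
      filter_upwards [Lp.coeFn_sub (T (hf.toLp f)) x, hT (hf.toLp f)] with t h1 h2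
      rw [h1, Pi.sub_apply, h2, RL_congr α hf.coeFn_toLp t]
    rw [eLpNorm_congr_ae h]
    exact (Lp.memLp _).2.ne

lemma Covers.exists_subset_closedBall (hT : ∀ f : Lp ℝ p unitVol, T f =ᵐ[unitVol] RL α f)
    {N : ℕ} {ε : ℝ} (hε : 0 ≤ ε) (h : Covers α p q N ε) :
    ∃ S : Finset (Lp ℝ q unitVol), S.card ≤ N ∧
      T '' Metric.closedBall 0 1 ⊆ ⋃ x ∈ S, Metric.closedBall x ε := by
  classical
  obtain ⟨S, hc, hm, hS⟩ := h
  refine ⟨S.attach.image fun h => (hm h.1 h.2).toLp h.1,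
    Finset.card_image_le.trans (by rwa [Finset.card_attach]), ?_⟩
  rintro _ ⟨f, hf, rfl⟩
  rw [mem_closedBall_zero_iff, Lp.norm_def] at hf
  obtain ⟨h, hh, he⟩ := hS f (Lp.memLp f) (by
    rw [← ENNReal.ofReal_one, ENNReal.le_ofReal_iff_toReal_le (Lp.memLp f).2.ne zero_le_one]
    exact hf)
  refine mem_iUnion₂.2 ⟨(hm h hh).toLp h,
    Finset.mem_image.2 ⟨⟨h, hh⟩, Finset.mem_attach _ _, rfl⟩, ?_⟩
  rw [Metric.mem_closedBall, dist_eq_norm, Lp.norm_def]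
  refine ENNReal.toReal_le_of_le_ofReal hε ((eLpNorm_congr_ae ?_).trans_le he)
  filter_upwards [Lp.coeFn_sub (T f) ((hm h hh).toLp h), hT f, (hm h hh).coeFn_toLp] with t h1 h2 h3
  rw [h1, Pi.sub_apply, h2, h3]

/-- Two-sided estimate of the dyadic entropy numbers of the Riemann–Liouville operator. -/
lemma opDyadEntropyNum_bounds (hα : 0 < α) (hθ : p⁻¹.toReal - q⁻¹.toReal < α)
    (hT : ∀ f : Lp ℝ p unitVol, T f =ᵐ[unitVol] RL α f) :
    ∃ c₁ > 0, ∃ c₂ > 0, ∀ n : ℕ, 1 ≤ n → c₁ * (n : ℝ) ^ (-α) ≤ opDyadEntropyNum T n ∧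
      opDyadEntropyNum T n ≤ c₂ * (n : ℝ) ^ (-α) := by
  obtain ⟨c₂, hc₂, hU⟩ := upperBound (p := p) (q := q) Fact.out hα hθ
  obtain ⟨c₁, hc₁, hL⟩ := lower_bound (p := p) (q := q) Fact.out Fact.out hα
  refine ⟨c₁, hc₁, c₂, hc₂, fun n hn => ?_⟩
  have hε : 0 ≤ c₂ * (n:ℝ) ^ (-α) := by positivity
  have hmem := (hU n hn).exists_subset_closedBall hT hε
  constructor
  · refine le_csInf ⟨_, hε, hmem⟩ ?_
    rintro ε ⟨hε0, S, hSc, hS⟩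
    refine le_of_forall_pos_le_add fun δ hδ => ?_
    exact hL n hn _ (by linarith) ((Covers.of_subset_closedBall hT hε0 hS).mono le_rfl le_rfl
      hSc (by linarith))
  · exact csInf_le ⟨0, fun ε hε => hε.1⟩ ⟨hε, hmem⟩

end Lp

end RiemannLiouville

/-- For `1 ≤ p, q ≤ ∞` and `max{1/p − 1/q, 0} < α < ∞`, the
Riemann–Liouville operator `R_α : L_p[0,1] → L_q[0,1]`,
`(R_α f)(t) = (1/Γ(α)) ∫₀ᵗ (t−x)^{α−1} f(x) dx`, satisfies `e_n(R_α) ∼ n^{-α}`. -/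
theorem stmt19 (p q : ENNReal) (hp : 1 ≤ p) (hq : 1 ≤ q) (α : ℝ)
    (hα : max ((1 / p).toReal - (1 / q).toReal) 0 < α) :
    letI : Fact (1 ≤ p) := ⟨hp⟩
    letI : Fact (1 ≤ q) := ⟨hq⟩
    ∀ T : Lp ℝ p (volume.restrict (Set.Icc (0:ℝ) 1)) →L[ℝ]
        Lp ℝ q (volume.restrict (Set.Icc (0:ℝ) 1)),
      (∀ f : Lp ℝ p (volume.restrict (Set.Icc (0:ℝ) 1)),
        ∀ᵐ t ∂(volume.restrict (Set.Icc (0:ℝ) 1)),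
          T f t = (1 / Real.Gamma α) * ∫ x in (0:ℝ)..t, (t - x) ^ (α - 1) * f x) →
      ∃ c₁ > 0, ∃ c₂ > 0, ∀ n : ℕ, 1 ≤ n →
        c₁ * (n : ℝ) ^ (-α) ≤ opDyadEntropyNum T n ∧
        opDyadEntropyNum T n ≤ c₂ * (n : ℝ) ^ (-α) := by
  intro T hT
  have : Fact (1 ≤ p) := ⟨hp⟩
  have : Fact (1 ≤ q) := ⟨hq⟩
  obtain ⟨hθ, hα0⟩ := max_lt_iff.1 hα
  rw [one_div, one_div] at hθ
  refine RiemannLiouville.opDyadEntropyNum_bounds hα0 hθ fun f => ?_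
  filter_upwards [hT f, ae_restrict_mem measurableSet_Icc] with t h1 ht
  rw [h1, RiemannLiouville.RL_eq_intervalIntegral α f ht]
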